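/- arXiv:1910.06185 — 2 statements merged into one kernel-verified Lean document; each statement's English description precedes it below -/
import Mathlib

section
/- Let P be a finite set of points in the Euclidean plane, not all collinear, let T be a triangulation of P, and let e be an edge of T such that the two triangles of T incident to e form a convex quadrilateral Q with diagonal e. Then T' = (T \ {e}) ∪ {e'}, where e' is the other diagonal of Q, is again a triangulation of P. -/
noncomputable section

/-- Points of the Euclidean plane. -/
abbrev Pt : Type := EuclideanSpace ℝ (Fin 2)

/-- The closed segment spanned by an unordered pair of points. -/
def segOf : Sym2 Pt → Set Pt :=
  Sym2.lift ⟨fun p q => segment ℝ p q, fun _ _ => segment_symm ℝ _ _⟩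

/-- The open segment (relative interior) spanned by an unordered pair of points. -/
def openSegOf : Sym2 Pt → Set Pt :=
  Sym2.lift ⟨fun p q => openSegment ℝ p q, fun _ _ => openSegment_symm ℝ _ _⟩

/-- A set of closed line segments (given by unordered pairs of distinct endpoints in `P`)
that pairwise intersect only in common endpoints and whose relative interiors contain
no point of `P`. -/
def ValidEdgeSet (P : Set Pt) (T : Set (Sym2 Pt)) : Prop :=
  (∀ e ∈ T, ¬ e.IsDiag) ∧
  (∀ e ∈ T, ∀ x ∈ e, x ∈ P) ∧
  (∀ e ∈ T, ∀ f ∈ T, e ≠ f → ∀ x, x ∈ segOf e → x ∈ segOf f → x ∈ e ∧ x ∈ f) ∧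
  (∀ e ∈ T, ∀ p ∈ P, p ∉ openSegOf e)

/-- A triangulation of `P`: a maximal valid edge set. -/
def IsTriangulation (P : Set Pt) (T : Set (Sym2 Pt)) : Prop :=
  ValidEdgeSet P T ∧ ∀ T', ValidEdgeSet P T' → T ⊆ T' → T' = T

/-- `a`, `b`, `c` span a triangle of the triangulation `T` of `P`. -/
def IsTriangleOf (P : Set Pt) (T : Set (Sym2 Pt)) (a b c : Pt) : Prop :=
  s(a, b) ∈ T ∧ s(b, c) ∈ T ∧ s(a, c) ∈ T ∧
  ¬ Collinear ℝ ({a, b, c} : Set Pt) ∧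
  ∀ p ∈ P, p ∈ convexHull ℝ ({a, b, c} : Set Pt) → p = a ∨ p = b ∨ p = c

/-- `e` is an edge of the triangle on `a`, `b`, `c`. -/
def EdgeOfTriangle (e : Sym2 Pt) (a b c : Pt) : Prop :=
  e = s(a, b) ∨ e = s(b, c) ∨ e = s(a, c)

/-- Two edges share a triangle of the triangulation `T`. -/
def ShareTriangle (P : Set Pt) (T : Set (Sym2 Pt)) (e f : Sym2 Pt) : Prop :=
  ∃ a b c, IsTriangleOf P T a b c ∧ EdgeOfTriangle e a b c ∧ EdgeOfTriangle f a b c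

/-- A set of points is in convex position. -/
def ConvexPosition (s : Set Pt) : Prop :=
  ∀ x ∈ s, x ∉ convexHull ℝ (s \ {x})

/-- A flip is recorded by its underlying edge `ε(f)` (first component) and its
resulting edge `φ(f)` (second component). -/
abbrev FlipData : Type := Sym2 Pt × Sym2 Pt

/-- The two triangles `abc` and `acd` of `T` incident to the edge `s(a,c)` form a
convex quadrilateral with diagonal `s(a,c)` (the other diagonal being `s(b,d)`). -/
def IsFlipQuad (P : Set Pt) (T : Set (Sym2 Pt)) (a b c d : Pt) : Prop :=
  IsTriangleOf P T a b c ∧ IsTriangleOf P T a c d ∧ b ≠ d ∧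
  ConvexPosition ({a, b, c, d} : Set Pt)

/-- The flip `f` is applicable in the triangulation `T` and transforms `T` into `T'`. -/
def FlipsTo (P : Set Pt) (T T' : Set (Sym2 Pt)) (f : FlipData) : Prop :=
  IsTriangulation P T ∧ f.1 ∈ T ∧
  ∃ a b c d, IsFlipQuad P T a b c d ∧ f.1 = s(a, c) ∧ f.2 = s(b, d) ∧
    T' = (T \ {f.1}) ∪ {f.2}

/-- `F` is a valid sequence of flips transforming `T` into `T'`. -/
def ValidSeq (P : Set Pt) : Set (Sym2 Pt) → List FlipData → Set (Sym2 Pt) → Prop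
  | T, [], T' => T = T'
  | T, f :: fs, T' => ∃ T₁, FlipsTo P T T₁ f ∧ ValidSeq P T₁ fs T'

/-- The flip distance between `T` and `T'` equals `k`. -/
def IsFlipDist (P : Set Pt) (T T' : Set (Sym2 Pt)) (k : ℕ) : Prop :=
  (∃ F : List FlipData, ValidSeq P T F T' ∧ F.length = k) ∧
  ∀ F : List FlipData, ValidSeq P T F T' → k ≤ F.length

/-- Apply a list of flips (as set operations) to a triangulation. -/
def applyFlips : Set (Sym2 Pt) → List FlipData → Set (Sym2 Pt)
  | T, [] => T
  | T, f :: fs => applyFlips ((T \ {f.1}) ∪ {f.2}) fs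

/-- The arc relation of the DAG `D_F` (on 0-based positions of the flips in `F`),
for a valid sequence `F` starting at `T₀`. -/
def Arc (P : Set Pt) (T₀ : Set (Sym2 Pt)) (F : List FlipData) (i j : ℕ) : Prop :=
  ∃ (hi : i < F.length) (hj : j < F.length), i < j ∧
    ((F.get ⟨i, hi⟩).2 = (F.get ⟨j, hj⟩).1 ∨
      ShareTriangle P (applyFlips T₀ (F.take j)) (F.get ⟨i, hi⟩).2 (F.get ⟨j, hj⟩).1) ∧
    ∀ p, ∀ hp : p < F.length, i < p → p < j → (F.get ⟨p, hp⟩).1 ≠ (F.get ⟨i, hi⟩).2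

/-- `F'` is a permutation of `F` that is a topological sorting of `D_F`. -/
def IsTopologicalSorting (P : Set Pt) (T₀ : Set (Sym2 Pt)) (F F' : List FlipData) : Prop :=
  ∃ (hlen : F'.length = F.length) (σ : Fin F.length ≃ Fin F.length),
    (∀ m : Fin F.length, F'.get (Fin.cast hlen.symm m) = F.get (σ m)) ∧
    ∀ m n : Fin F.length, Arc P T₀ F (σ m) (σ n) → m < n


theorem exists_affineBasis_of_not_collinear {a b c : Pt}
    (h : ¬ Collinear ℝ ({a, b, c} : Set Pt)) :
    ∃ B : AffineBasis (Fin 3) ℝ Pt, B 0 = a ∧ B 1 = b ∧ B 2 = c := by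
  have hi : AffineIndependent ℝ ![a, b, c] := affineIndependent_iff_not_collinear_set.2 h
  have ht : affineSpan ℝ (Set.range ![a, b, c]) = ⊤ := by
    rw [hi.affineSpan_eq_top_iff_card_eq_finrank_add_one]
    simp
  exact ⟨⟨![a, b, c], hi, ht⟩, rfl, rfl, rfl⟩

theorem AffineBasis.coord_combo (B : AffineBasis (Fin 3) ℝ Pt) (i : Fin 3) {u v : ℝ}
    (h : u + v = 1) (x y : Pt) :
    B.coord i (u • x + v • y) = u * B.coord i x + v * B.coord i y := by
  simpa using Convex.combo_affine_apply (f := B.coord i) (x := x) (y := y) h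

theorem AffineBasis.coord_combo_three (B : AffineBasis (Fin 3) ℝ Pt) {u v w : ℝ}
    (h : u + v + w = 1) :
    B.coord 0 (u • B 0 + v • B 1 + w • B 2) = u ∧
      B.coord 1 (u • B 0 + v • B 1 + w • B 2) = v ∧
      B.coord 2 (u • B 0 + v • B 1 + w • B 2) = w := by
  have key : ∀ i : Fin 3, B.coord i (Finset.univ.affineCombination ℝ B ![u, v, w]) =
      ![u, v, w] i := fun i =>
    B.coord_apply_combination_of_mem (Finset.mem_univ i) (by simp [Fin.sum_univ_three, h])
  rw [Finset.affineCombination_eq_linear_combination _ _ _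
    (by simp [Fin.sum_univ_three, h])] at key
  simp only [Fin.sum_univ_three] at key
  exact ⟨key 0, key 1, key 2⟩

theorem AffineBasis.eq_combo_three (B : AffineBasis (Fin 3) ℝ Pt) (x : Pt) :
    B.coord 0 x + B.coord 1 x + B.coord 2 x = 1 ∧
      x = B.coord 0 x • B 0 + B.coord 1 x • B 1 + B.coord 2 x • B 2 := by
  constructor
  · have := B.sum_coord_apply_eq_one x
    rwa [Fin.sum_univ_three] at this
  · have := B.linear_combination_coord_eq_self x
    rw [Fin.sum_univ_three] at this
    exact this.symm

theorem mem_segOf {p q x : Pt} : x ∈ segOf s(p, q) ↔ x ∈ segment ℝ p q := Iff.rfl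

/-- A point of the boundary of a triangle lies on one of the edges. -/
theorem AffineBasis.exists_mem_segment (B : AffineBasis (Fin 3) ℝ Pt) {y : Pt}
    (h0 : ∀ i, 0 ≤ B.coord i y) {k : Fin 3} (hk : B.coord k y = 0) :
    ∃ i j, i ≠ j ∧ i ≠ k ∧ j ≠ k ∧ y ∈ segment ℝ (B i) (B j) := by
  obtain ⟨hs, hy⟩ := B.eq_combo_three y
  fin_cases k
  · refine ⟨1, 2, by decide, by decide, by decide, _, _, h0 1, h0 2, ?_, ?_⟩
    · simp at hk; linarith
    · simp at hk; rw [hk] at hy; simpa using hy.symm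
  · refine ⟨0, 2, by decide, by decide, by decide, _, _, h0 0, h0 2, ?_, ?_⟩
    · simp at hk; linarith
    · simp at hk; rw [hk] at hy; simpa using hy.symm
  · refine ⟨0, 1, by decide, by decide, by decide, _, _, h0 0, h0 1, ?_, ?_⟩
    · simp at hk; linarith
    · simp at hk; rw [hk] at hy; simpa using hy.symm

/-- A segment from the interior of a triangle to a point outside meets the boundary. -/
theorem AffineBasis.exists_boundary_point (B : AffineBasis (Fin 3) ℝ Pt) {x p : Pt}
    (hx : ∀ i, 0 < B.coord i x) {m : Fin 3} (hp : B.coord m p < 0) :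
    ∃ y ∈ openSegment ℝ x p, (∀ i, 0 ≤ B.coord i y) ∧ ∃ k, B.coord k y = 0 := by
  let g : Fin 3 → ℝ → ℝ := fun i t => (1 - t) * B.coord i x + t * B.coord i p
  have hg : ∀ i, Continuous (g i) := fun i => by fun_prop
  let φ : ℝ → ℝ := fun t => min (g 0 t) (min (g 1 t) (g 2 t))
  have hφ : Continuous φ := (hg 0).min ((hg 1).min (hg 2))
  have hle : ∀ i t, φ t ≤ g i t := by
    intro i t
    fin_cases i <;> simp [φ]
  have h0 : 0 < φ 0 := by simp [φ, g, hx]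
  have h1 : φ 1 < 0 := (hle m 1).trans_lt (by simpa [g] using hp)
  obtain ⟨t, ⟨ht0, ht1⟩, ht⟩ :=
    intermediate_value_Ioo' (zero_le_one' ℝ) hφ.continuousOn ⟨h1, h0⟩
  have hc : ∀ i, B.coord i ((1 - t) • x + t • p) = g i t := fun i =>
    B.coord_combo i (by ring) x p
  refine ⟨(1 - t) • x + t • p, ⟨1 - t, t, by linarith, ht0, by ring, rfl⟩,
    fun i => by rw [hc, ← ht]; exact hle i t, ?_⟩
  have : φ t = g 0 t ∨ φ t = g 1 t ∨ φ t = g 2 t := by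
    simp only [φ]
    rcases min_choice (g 0 t) (min (g 1 t) (g 2 t)) with h | h
    · exact Or.inl h
    · rw [h]; exact Or.inr (min_choice _ _)
  rcases this with h | h | h
  exacts [⟨0, by rw [hc, ← h, ht]⟩, ⟨1, by rw [hc, ← h, ht]⟩, ⟨2, by rw [hc, ← h, ht]⟩]

theorem openSegment_subset_of_mem_segment {x y p q : Pt} (hx : x ∈ segment ℝ p q) (hne : x ≠ p)
    (hy : y ∈ openSegment ℝ x p) : y ∈ openSegment ℝ p q := by
  obtain ⟨u, v, hu, hv, huv, rfl⟩ := hx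
  obtain ⟨s, t, hs, ht, hst, rfl⟩ := hy
  have hv' : 0 < v := by
    refine hv.lt_of_ne' fun h => hne ?_
    subst h
    simp [show u = 1 by linarith]
  refine ⟨s * u + t, s * v, by positivity, by positivity, ?_, by module⟩
  linear_combination s * huv + hst

theorem AffineBasis.coord_eq_zero_of_mem_segment (B : AffineBasis (Fin 3) ℝ Pt) {i j k : Fin 3}
    (hi : i ≠ k) (hj : j ≠ k) {x : Pt} (hx : x ∈ segment ℝ (B i) (B j)) : B.coord k x = 0 := by
  obtain ⟨u, v, -, -, huv, rfl⟩ := hx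
  rw [B.coord_combo k huv, B.coord_apply_ne hi.symm, B.coord_apply_ne hj.symm]
  simp

/-- An edge meeting the interior of an empty triangle starts at a vertex of the triangle. -/
theorem ValidEdgeSet.eq_vertex {P : Set Pt} {V : Set (Sym2 Pt)} (hV : ValidEdgeSet P V)
    (B : AffineBasis (Fin 3) ℝ Pt) (hE : ∀ i j, i ≠ j → s(B i, B j) ∈ V)
    (hP : ∀ p ∈ P, (∀ i, 0 ≤ B.coord i p) → ∃ i, p = B i) {x p q : Pt}
    (hx : ∀ i, 0 < B.coord i x) (hpq : s(p, q) ∈ V) (hxs : x ∈ segment ℝ p q) :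
    ∃ i, p = B i := by
  obtain ⟨-, hmem, hcross, hopen⟩ := hV
  refine hP p (hmem _ hpq p (by simp)) fun m => ?_
  by_contra! hm
  obtain ⟨y, hy, hy0, k, hk⟩ := B.exists_boundary_point hx hm
  obtain ⟨i, j, hij, hik, hjk, hys⟩ := B.exists_mem_segment hy0 hk
  have hxp : x ≠ p := fun h => (hm.trans (hx m)).ne (by rw [h])
  have hyo : y ∈ openSegment ℝ p q := openSegment_subset_of_mem_segment hxs hxp hy
  have hne : s(B i, B j) ≠ s(p, q) := by
    intro h
    have hx' : x ∈ segOf s(B i, B j) := by rw [h]; exact hxs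
    exact (hx k).ne' (B.coord_eq_zero_of_mem_segment hik hjk hx')
  have hyp := (hcross _ (hE i j hij) _ hpq hne y hys (openSegment_subset_segment _ _ _ hyo)).2
  exact hopen _ hpq y (hmem _ hpq y hyp) hyo

theorem ValidEdgeSet.notMem_interior {P : Set Pt} {V : Set (Sym2 Pt)} (hV : ValidEdgeSet P V)
    (B : AffineBasis (Fin 3) ℝ Pt) (hE : ∀ i j, i ≠ j → s(B i, B j) ∈ V)
    (hP : ∀ p ∈ P, (∀ i, 0 ≤ B.coord i p) → ∃ i, p = B i) {x : Pt}
    (hx : ∀ i, 0 < B.coord i x) {f : Sym2 Pt} (hf : f ∈ V) : x ∉ segOf f := by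
  induction f with | h p q => ?_
  intro hxs
  obtain ⟨i, rfl⟩ := hV.eq_vertex B hE hP hx hf hxs
  obtain ⟨j, rfl⟩ := hV.eq_vertex B hE hP hx (by rwa [Sym2.eq_swap])
    (by rw [segment_symm]; exact hxs)
  have hthird : ∀ i j : Fin 3, ∃ k, i ≠ k ∧ j ≠ k := by decide
  obtain ⟨k, hik, hjk⟩ := hthird i j
  exact (hx k).ne' (B.coord_eq_zero_of_mem_segment hik hjk hxs)

theorem mem_convexHull_triple {a b c x : Pt} :
    x ∈ convexHull ℝ ({a, b, c} : Set Pt) ↔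
      ∃ u v w : ℝ, 0 ≤ u ∧ 0 ≤ v ∧ 0 ≤ w ∧ u + v + w = 1 ∧ u • a + v • b + w • c = x := by
  rw [convexHull_insert ⟨b, by simp⟩, convexHull_pair]
  simp only [mem_convexJoin, Set.mem_singleton_iff, exists_eq_left]
  constructor
  · rintro ⟨y, ⟨s, t, hs, ht, hst, rfl⟩, u, v, hu, hv, huv, rfl⟩
    refine ⟨u, v * s, v * t, hu, by positivity, by positivity, ?_, by module⟩
    linear_combination v * hst + huv
  · rintro ⟨u, v, w, hu, hv, hw, h, rfl⟩
    rcases (add_nonneg hv hw).eq_or_lt with h0 | h0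
    · obtain rfl : v = 0 := by linarith
      obtain rfl : w = 0 := by linarith
      exact ⟨b, left_mem_segment _ _ _, 1, 0, by simp, by simp, by simp,
        by simp [show u = 1 by linarith]⟩
    · refine ⟨(v / (v + w)) • b + (w / (v + w)) • c,
        ⟨_, _, by positivity, by positivity, by field_simp, rfl⟩,
        u, v + w, hu, h0.le, by linarith, ?_⟩
      match_scalars <;> field_simp

/-- No edge and no point of `P` meets the interior of an empty triangle. -/
theorem IsTriangleOf.interior_empty {P : Set Pt} {V : Set (Sym2 Pt)} (hV : ValidEdgeSet P V)
    {a b c : Pt} (h : IsTriangleOf P V a b c) {u v w : ℝ} (hu : 0 < u) (hv : 0 < v) (hw : 0 < w)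
    (hs : u + v + w = 1) {x : Pt} (hx : x = u • a + v • b + w • c) :
    x ∉ P ∧ ∀ f ∈ V, x ∉ segOf f := by
  obtain ⟨hab, hbc, hac, hnc, hP⟩ := h
  obtain ⟨B, rfl, rfl, rfl⟩ := exists_affineBasis_of_not_collinear hnc
  have hx' : ∀ i, 0 < B.coord i x := by
    obtain ⟨h0, h1, h2⟩ := B.coord_combo_three hs
    rw [hx]
    intro i
    fin_cases i
    exacts [h0.symm ▸ hu, h1.symm ▸ hv, h2.symm ▸ hw]
  have hP' : ∀ p ∈ P, (∀ i, 0 ≤ B.coord i p) → ∃ i, p = B i := by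
    intro p hp h0
    obtain ⟨h1, h2⟩ := B.eq_combo_three p
    rcases hP p hp (mem_convexHull_triple.2 ⟨_, _, _, h0 0, h0 1, h0 2, h1, h2.symm⟩)
      with h | h | h
    exacts [⟨0, h⟩, ⟨1, h⟩, ⟨2, h⟩]
  have hE : ∀ i j, i ≠ j → s(B i, B j) ∈ V := by
    intro i j hij
    fin_cases i <;> fin_cases j <;> first | exact absurd rfl hij | skip
    exacts [hab, hac, by rwa [Sym2.eq_swap], hbc, by rwa [Sym2.eq_swap], by rwa [Sym2.eq_swap]]
  refine ⟨fun hxP => ?_, fun f hf => hV.notMem_interior B hE hP' hx' hf⟩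
  obtain ⟨i, rfl⟩ := hP' x hxP fun i => (hx' i).le
  obtain ⟨k, hk⟩ : ∃ k, k ≠ i := exists_ne i
  exact (hx' k).ne' (B.coord_apply_ne hk)

theorem mem_of_mem_segOf {P : Set Pt} {V : Set (Sym2 Pt)} (hV : ValidEdgeSet P V) {f : Sym2 Pt}
    (hf : f ∈ V) {p : Pt} (hp : p ∈ P) (hpf : p ∈ segOf f) : p ∈ f := by
  induction f with | h q r => ?_
  by_contra hn
  simp only [Sym2.mem_iff, not_or] at hn
  exact hV.2.2.2 _ hf p hp (mem_openSegment_of_ne_left_right (Ne.symm hn.1) (Ne.symm hn.2) hpf)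

theorem openSegment_trichotomy {b d o x : Pt} (ho : o ∈ openSegment ℝ b d)
    (hx : x ∈ openSegment ℝ b d) :
    x = o ∨ x ∈ openSegment ℝ b o ∨ x ∈ openSegment ℝ d o := by
  obtain ⟨s, t, hs, ht, hst, rfl⟩ := ho
  obtain ⟨u, v, hu, hv, huv, rfl⟩ := hx
  obtain rfl : s = 1 - t := by linarith
  obtain rfl : u = 1 - v := by linarith
  rcases lt_trichotomy v t with h | rfl | h
  · refine Or.inr (Or.inl ⟨1 - v / t, v / t, ?_, by positivity, by ring, ?_⟩)
    · rw [sub_pos, div_lt_one ht]; exact h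
    · match_scalars <;> field_simp <;> ring
  · exact Or.inl rfl
  · refine Or.inr (Or.inr ⟨1 - (1 - v) / (1 - t), (1 - v) / (1 - t), ?_, by positivity,
      by ring, ?_⟩)
    · rw [sub_pos, div_lt_one hs]; linarith
    · match_scalars <;> field_simp <;> ring

theorem openSegment_interior {a b c o x : Pt} (ho : o ∈ openSegment ℝ a c)
    (hx : x ∈ openSegment ℝ b o) :
    ∃ u v w : ℝ, 0 < u ∧ 0 < v ∧ 0 < w ∧ u + v + w = 1 ∧ x = u • a + v • b + w • c := by
  obtain ⟨s, t, hs, ht, hst, rfl⟩ := ho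
  obtain ⟨u, v, hu, hv, huv, rfl⟩ := hx
  refine ⟨v * s, u, v * t, by positivity, hu, by positivity, ?_, by module⟩
  linear_combination v * hst + huv

/-- The other diagonal of a convex quadrilateral made of two empty triangles only meets `P`
in its endpoints, and only meets edges in common endpoints. -/
theorem diagonal_free {P : Set Pt} {V : Set (Sym2 Pt)} (hV : ValidEdgeSet P V) {a b c d o : Pt}
    (h₁ : IsTriangleOf P V a b c) (h₂ : IsTriangleOf P V a c d)
    (hoac : o ∈ openSegment ℝ a c) (hobd : o ∈ openSegment ℝ b d) {x : Pt}
    (hx : x ∈ openSegment ℝ b d) :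
    x ∉ P ∧ ∀ f ∈ V, f ≠ s(a, c) → x ∉ segOf f := by
  rcases openSegment_trichotomy hobd hx with rfl | h | h
  · have hac : s(a, c) ∈ V := h₁.2.2.1
    have hxP : x ∉ P := fun hp => hV.2.2.2 _ hac x hp hoac
    refine ⟨hxP, fun f hf hne hxf => hxP ?_⟩
    exact hV.2.1 f hf x (hV.2.2.1 f hf _ hac hne x hxf (openSegment_subset_segment _ _ _ hoac)).1
  · obtain ⟨u, v, w, hu, hv, hw, hs, rfl⟩ := openSegment_interior hoac h
    obtain ⟨hP, hf⟩ := h₁.interior_empty hV hu hv hw hs rfl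
    exact ⟨hP, fun f hfV _ => hf f hfV⟩
  · obtain ⟨u, v, w, hu, hv, hw, hs, hx'⟩ := openSegment_interior hoac h
    obtain ⟨hP, hf⟩ := h₂.interior_empty hV hu hw hv (by linarith) (x := x)
      (by rw [hx']; abel)
    exact ⟨hP, fun f hfV _ => hf f hfV⟩

theorem ValidEdgeSet.flip {P : Set Pt} {V : Set (Sym2 Pt)} (hV : ValidEdgeSet P V)
    {a b c d o : Pt} (h₁ : IsTriangleOf P V a b c) (h₂ : IsTriangleOf P V a c d) (hbd : b ≠ d)
    (hoac : o ∈ openSegment ℝ a c) (hobd : o ∈ openSegment ℝ b d) :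
    ValidEdgeSet P ((V \ {s(a, c)}) ∪ {s(b, d)}) := by
  have hfree := fun x hx => diagonal_free hV h₁ h₂ hoac hobd (x := x) hx
  have hbP : b ∈ P := hV.2.1 _ h₁.1 b (by simp)
  have hdP : d ∈ P := hV.2.1 _ h₂.2.1 d (by simp)
  have hcross : ∀ f ∈ V, f ≠ s(a, c) → ∀ x, x ∈ segOf f → x ∈ segOf s(b, d) →
      x ∈ f ∧ x ∈ s(b, d) := by
    intro f hf hne x hxf hx
    by_cases hxb : x = b
    · subst hxb; exact ⟨mem_of_mem_segOf hV hf hbP hxf, by simp⟩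
    by_cases hxd : x = d
    · subst hxd; exact ⟨mem_of_mem_segOf hV hf hdP hxf, by simp⟩
    exact absurd hxf ((hfree x (mem_openSegment_of_ne_left_right (Ne.symm hxb) (Ne.symm hxd)
      hx)).2 f hf hne)
  refine ⟨?_, ?_, ?_, ?_⟩
  · rintro e (⟨he, -⟩ | rfl)
    · exact hV.1 e he
    · simpa using hbd
  · rintro e (⟨he, -⟩ | rfl) x hx
    · exact hV.2.1 e he x hx
    · rcases Sym2.mem_iff.1 hx with rfl | rfl <;> assumption
  · rintro e (⟨he, he'⟩ | rfl) f (⟨hf, hf'⟩ | rfl) hne x hxe hxf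
    · exact hV.2.2.1 e he f hf hne x hxe hxf
    · exact hcross e he he' x hxe hxf
    · exact (hcross f hf hf' x hxf hxe).symm
    · exact absurd rfl hne
  · rintro e (⟨he, -⟩ | rfl) p hp
    · exact hV.2.2.2 e he p hp
    · exact fun hpo => (hfree p hpo).1 hp

theorem convexHull_triple_subset {a b c d o : Pt} (hoac : o ∈ openSegment ℝ a c)
    (hobd : o ∈ openSegment ℝ b d) :
    convexHull ℝ ({a, b, d} : Set Pt) ⊆
      convexHull ℝ ({a, b, c} : Set Pt) ∪ convexHull ℝ ({a, c, d} : Set Pt) := by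
  intro x hx
  obtain ⟨l, m, n, hl, hm, hn, hs, rfl⟩ := mem_convexHull_triple.1 hx
  obtain ⟨s, t, hs0, ht0, hst, rfl⟩ := hoac
  obtain ⟨u, v, hu, hv, huv, ho⟩ := hobd
  simp only [Set.mem_union, mem_convexHull_triple]
  rcases le_total (n * u) (m * v) with h | h
  · have hd : d = (1 / v) • (s • a + t • c - u • b) := by
      rw [← ho]; match_scalars <;> field_simp; ring
    refine Or.inl ⟨l + n * s / v, m - n * u / v, n * t / v, by positivity, ?_, by positivity,
      ?_, ?_⟩
    · rw [sub_nonneg, div_le_iff₀ hv]; exact h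
    · field_simp
      linear_combination v * hs + n * hst - n * huv
    · rw [hd]; module
  · have hb : b = (1 / u) • (s • a + t • c - v • d) := by
      rw [← ho]; match_scalars <;> field_simp; ring
    refine Or.inr ⟨l + m * s / u, m * t / u, n - m * v / u, by positivity, by positivity, ?_,
      ?_, ?_⟩
    · rw [sub_nonneg, div_le_iff₀ hu]; exact h
    · field_simp
      linear_combination u * hs + m * hst - m * huv
    · rw [hb]; module

theorem triple_empty_of_crossing {P : Set Pt} {a b c d o : Pt}
    (h₁ : ∀ p ∈ P, p ∈ convexHull ℝ ({a, b, c} : Set Pt) → p = a ∨ p = b ∨ p = c)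
    (h₂ : ∀ p ∈ P, p ∈ convexHull ℝ ({a, c, d} : Set Pt) → p = a ∨ p = c ∨ p = d)
    (hoac : o ∈ openSegment ℝ a c) (hobd : o ∈ openSegment ℝ b d)
    (hc : c ∉ convexHull ℝ ({a, b, d} : Set Pt)) :
    ∀ p ∈ P, p ∈ convexHull ℝ ({a, b, d} : Set Pt) → p = a ∨ p = b ∨ p = d := by
  intro p hp hpm
  have hpc : p ≠ c := fun h => hc (h ▸ hpm)
  rcases convexHull_triple_subset hoac hobd hpm with h | h
  · have := h₁ p hp h
    tauto
  · have := h₂ p hp h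
    tauto

theorem ConvexPosition.notMem_convexHull {s : Set Pt} (hs : ConvexPosition s) {x p q r : Pt}
    (hx : x ∈ s) (hp : p ∈ s) (hq : q ∈ s) (hr : r ∈ s) (hpx : p ≠ x) (hqx : q ≠ x)
    (hrx : r ≠ x) : x ∉ convexHull ℝ ({p, q, r} : Set Pt) := by
  refine fun h => hs x hx (convexHull_mono ?_ h)
  rintro y (rfl | rfl | rfl)
  exacts [⟨hp, hpx⟩, ⟨hq, hqx⟩, ⟨hr, hrx⟩]

theorem ConvexPosition.not_collinear {s : Set Pt} (hs : ConvexPosition s) {p q r : Pt}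
    (hp : p ∈ s) (hq : q ∈ s) (hr : r ∈ s) (hpq : p ≠ q) (hqr : q ≠ r) (hpr : p ≠ r) :
    ¬ Collinear ℝ ({p, q, r} : Set Pt) := by
  intro h
  have key : ∀ {x y z : Pt}, x ∈ s → y ∈ s → z ∈ s → x ≠ y → z ≠ y → ¬ Wbtw ℝ x y z := by
    intro x y z hx hy hz hxy hzy hw
    refine hs.notMem_convexHull hy hx hx hz hxy hxy hzy ?_
    rw [Set.insert_eq_of_mem (Set.mem_insert _ _), convexHull_pair]
    exact mem_segment_iff_wbtw.2 hw
  rcases h.wbtw_or_wbtw_or_wbtw with h | h | h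
  · exact key hp hq hr hpq hqr.symm h
  · exact key hq hr hp hqr hpr h
  · exact key hr hp hq hpr.symm hpq.symm h

/-- In a convex quadrilateral made of two triangles of a valid edge set, the diagonals cross. -/
theorem exists_diagonal_crossing {P : Set Pt} {V : Set (Sym2 Pt)} (hV : ValidEdgeSet P V)
    {a b c d : Pt} (h₁ : IsTriangleOf P V a b c) (h₂ : IsTriangleOf P V a c d) (hbd : b ≠ d)
    (hconv : ConvexPosition ({a, b, c, d} : Set Pt)) :
    ∃ o, o ∈ openSegment ℝ a c ∧ o ∈ openSegment ℝ b d := by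
  obtain ⟨hab, hbc, hac, hnc, -⟩ := h₁
  obtain ⟨-, hcd, had, hnc', -⟩ := h₂
  have hab' : a ≠ b := hV.1 _ hab
  have hbc' : b ≠ c := hV.1 _ hbc
  have hac' : a ≠ c := hV.1 _ hac
  have hcd' : c ≠ d := hV.1 _ hcd
  have had' : a ≠ d := hV.1 _ had
  obtain ⟨α, β, γ, hs, hd⟩ : ∃ α β γ : ℝ, α + β + γ = 1 ∧ d = α • a + β • b + γ • c := by
    obtain ⟨B, rfl, rfl, rfl⟩ := exists_affineBasis_of_not_collinear hnc
    exact ⟨_, _, _, B.eq_combo_three d⟩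
  have hβ0 : β ≠ 0 := by
    rintro rfl
    refine hnc' ?_
    have hda : d = AffineMap.lineMap a c γ := by
      rw [hd, AffineMap.lineMap_apply_module, show α = 1 - γ by linarith]
      module
    have := collinear_insert_of_mem_affineSpan_pair
      (hda ▸ AffineMap.lineMap_mem_affineSpan_pair γ a c : d ∈ line[ℝ, a, c])
    rwa [show ({a, c, d} : Set Pt) = {d, a, c} by ext; simp; tauto]
  have nd := hconv.notMem_convexHull (x := d) (p := a) (q := b) (r := c) (by simp) (by simp)
    (by simp) (by simp) had' hbd hcd'
  have na := hconv.notMem_convexHull (x := a) (p := d) (q := b) (r := c) (by simp) (by simp)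
    (by simp) (by simp) had'.symm hab'.symm hac'.symm
  have nb := hconv.notMem_convexHull (x := b) (p := d) (q := a) (r := c) (by simp) (by simp)
    (by simp) (by simp) hbd.symm hab' hbc'.symm
  have nc := hconv.notMem_convexHull (x := c) (p := d) (q := a) (r := b) (by simp) (by simp)
    (by simp) (by simp) hcd'.symm hac' hbc'
  rw [mem_convexHull_triple] at nd na nb nc
  rcases lt_or_gt_of_ne hβ0 with hβ | hβ
  · have hα : 0 < α := by
      by_contra! hα
      have hγ : 0 < γ := by linarith
      refine nc ⟨1 / γ, -α / γ, -β / γ, by positivity, div_nonneg (by linarith) hγ.le,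
        div_nonneg (by linarith) hγ.le, ?_, ?_⟩
      · field_simp; linarith
      · rw [hd]; match_scalars <;> field_simp <;> ring
    have hγ : 0 < γ := by
      by_contra! hγ
      refine na ⟨1 / α, -β / α, -γ / α, by positivity, div_nonneg (by linarith) hα.le,
        div_nonneg (by linarith) hα.le, ?_, ?_⟩
      · field_simp; linarith
      · rw [hd]; match_scalars <;> field_simp <;> ring
    have hβ' : 0 < 1 - β := by linarith
    refine ⟨(α / (1 - β)) • a + (γ / (1 - β)) • c,
      ⟨_, _, by positivity, by positivity, ?_, rfl⟩,
      ⟨-β / (1 - β), 1 / (1 - β), div_pos (by linarith) hβ', by positivity, ?_, ?_⟩⟩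
    · field_simp; linarith
    · field_simp; ring
    · rw [hd]; match_scalars <;> field_simp <;> ring
  · exfalso
    rcases lt_or_ge α 0 with hα | hα <;> rcases lt_or_ge γ 0 with hγ | hγ
    · refine nb ⟨1 / β, -α / β, -γ / β, by positivity, div_nonneg (by linarith) hβ.le,
        div_nonneg (by linarith) hβ.le, ?_, ?_⟩
      · field_simp; linarith
      · rw [hd]; match_scalars <;> field_simp <;> ring
    · have hα' : 0 < 1 - α := by linarith
      have := (hV.2.2.1 _ had _ hbc (by simp [hab', hac']) ((β / (1 - α)) • b + (γ / (1 - α)) • c)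
        (mem_segOf.2 ⟨-α / (1 - α), 1 / (1 - α), div_nonneg (by linarith) hα'.le, by positivity,
          by field_simp; ring, by rw [hd]; match_scalars <;> field_simp <;> ring⟩)
        (mem_segOf.2 ⟨_, _, by positivity, by positivity, by field_simp; linarith, rfl⟩))
      simp only [Sym2.mem_iff] at this
      rcases this with ⟨h | h, h' | h'⟩ <;> rw [h] at h' <;> simp_all
    · have hγ' : 0 < 1 - γ := by linarith
      have := (hV.2.2.1 _ hcd _ hab (by simp [hac'.symm, hbc'.symm])
        ((α / (1 - γ)) • a + (β / (1 - γ)) • b)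
        (mem_segOf.2 ⟨-γ / (1 - γ), 1 / (1 - γ), div_nonneg (by linarith) hγ'.le, by positivity,
          by field_simp; ring, by rw [hd]; match_scalars <;> field_simp <;> ring⟩)
        (mem_segOf.2 ⟨_, _, by positivity, by positivity, by field_simp; linarith, rfl⟩))
      simp only [Sym2.mem_iff] at this
      rcases this with ⟨h | h, h' | h'⟩ <;> rw [h] at h' <;> simp_all
    · exact nd ⟨α, β, γ, hα, hβ.le, hγ, hs, hd.symm⟩

/-- Two edges of a valid edge set do not cross. -/
theorem ValidEdgeSet.not_crossing {P : Set Pt} {V : Set (Sym2 Pt)} (hV : ValidEdgeSet P V)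
    {a b c d o : Pt} (hac : s(a, c) ∈ V) (hne : s(a, c) ≠ s(b, d))
    (hoac : o ∈ openSegment ℝ a c) (hobd : o ∈ openSegment ℝ b d) : s(b, d) ∉ V := by
  intro hbd
  have ho := (hV.2.2.1 _ hac _ hbd hne o (openSegment_subset_segment _ _ _ hoac)
    (openSegment_subset_segment _ _ _ hobd)).1
  exact hV.2.2.2 _ hac o (hV.2.1 _ hac o ho) hoac

/-- Flipping a diagonal of a convex quadrilateral in a triangulation of `P`
yields again a triangulation of `P`. -/
theorem flip_yields_triangulation
    (P : Set Pt) (hfin : P.Finite) (hncol : ¬ Collinear ℝ P)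
    (T : Set (Sym2 Pt)) (hT : IsTriangulation P T)
    (a b c d : Pt) (he : s(a, c) ∈ T)
    (hquad : IsFlipQuad P T a b c d) :
    IsTriangulation P ((T \ {s(a, c)}) ∪ {s(b, d)}) := by
  obtain ⟨h₁, h₂, hbd, hconv⟩ := hquad
  obtain ⟨hV, hmax⟩ := hT
  obtain ⟨o, hoac, hobd⟩ := exists_diagonal_crossing hV h₁ h₂ hbd hconv
  refine ⟨hV.flip h₁ h₂ hbd hoac hobd, fun V' hV' hsub => ?_⟩
  obtain ⟨hab, hbc, -, -, he₁⟩ := h₁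
  obtain ⟨-, hcd, had, -, he₂⟩ := h₂
  have hab' : a ≠ b := hV.1 _ hab
  have hbc' : b ≠ c := hV.1 _ hbc
  have hac' : a ≠ c := hV.1 _ he
  have hcd' : c ≠ d := hV.1 _ hcd
  have had' : a ≠ d := hV.1 _ had
  have hne : s(a, c) ≠ s(b, d) := by simp [hab', had']
  have hbdT : s(b, d) ∉ T := hV.not_crossing he hne hoac hobd
  have hbdV' : s(b, d) ∈ V' := hsub (Or.inr rfl)
  have hacV' : s(a, c) ∉ V' := hV'.not_crossing hbdV' hne.symm hobd hoac
  have hT' : ∀ f ∈ T, f ≠ s(a, c) → f ∈ V' := fun f hf hfne => hsub (Or.inl ⟨hf, hfne⟩)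
  have hobd' : o ∈ openSegment ℝ d b := by rwa [openSegment_symm]
  have hoca : o ∈ openSegment ℝ c a := by rwa [openSegment_symm]
  have t₁ : IsTriangleOf P V' b c d := by
    refine ⟨hT' _ hbc (by simp [hab'.symm, hbc']), hT' _ hcd (by simp [hac'.symm, had'.symm]),
      hbdV', hconv.not_collinear (by simp) (by simp) (by simp) hbc' hcd' hbd, ?_⟩
    have := triple_empty_of_crossing (P := P) (a := c) (b := b) (c := a) (d := d) (o := o)
      (fun p hp h => by
        have := he₁ p hp (by
          rwa [show ({a, b, c} : Set Pt) = {c, b, a} by ext; simp; tauto])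
        tauto)
      (fun p hp h => by
        have := he₂ p hp (by
          rwa [show ({a, c, d} : Set Pt) = {c, a, d} by ext; simp; tauto])
        tauto)
      hoca hobd (hconv.notMem_convexHull (by simp) (by simp) (by simp) (by simp) hac'.symm
        hab'.symm had'.symm)
    intro p hp h
    rw [Set.insert_comm] at h
    have := this p hp h
    tauto
  have t₂ : IsTriangleOf P V' b d a := by
    refine ⟨hbdV', hT' _ (by rwa [Sym2.eq_swap]) (by simp [hcd'.symm, had'.symm]),
      hT' _ (by rwa [Sym2.eq_swap]) (by simp [hab'.symm, hbc']),
      hconv.not_collinear (by simp) (by simp) (by simp) hbd had'.symm hab'.symm, ?_⟩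
    have := triple_empty_of_crossing he₁ he₂
      hoac hobd (hconv.notMem_convexHull (by simp) (by simp) (by simp) (by simp) hac'
        hbc' hcd'.symm)
    intro p hp h
    rw [show ({b, d, a} : Set Pt) = {a, b, d} by ext; simp; tauto] at h
    have := this p hp h
    tauto
  have hW := hV'.flip t₁ t₂ hac'.symm hobd hoca
  have hWT := hmax _ hW fun f hf => by
    by_cases hfe : f = s(a, c)
    · exact Or.inr (by rw [hfe]; exact Sym2.eq_swap)
    · exact Or.inl ⟨hT' f hf hfe, fun h => hbdT (by rwa [← Set.mem_singleton_iff.1 h])⟩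
  refine Set.Subset.antisymm (fun f hf => ?_) hsub
  by_cases hfb : f = s(b, d)
  · exact Or.inr hfb
  · refine Or.inl ⟨hWT ▸ Or.inl ⟨hf, hfb⟩, fun h => hacV' ?_⟩
    rwa [← Set.mem_singleton_iff.1 h]

end
end

section
/- (Lemma 1) Let T_0 and T_r be triangulations of P and let F = ⟨f_1, f_2, …, f_r⟩ be a valid sequence of flips transforming T_0 into T_r. Let π(F) be any permutation of the flips in F that is a topological sorting of the directed acyclic graph D_F. Then π(F) is a valid sequence of flips transforming T_0 into T_r. -/
noncomputable section

section Barycentric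

variable {a b c d x y u v : Pt}

lemma not_collinear_iff_bary : ¬ Collinear ℝ ({a, b, c} : Set Pt) ↔
    ∀ α β γ : ℝ, α + β + γ = 0 → α • a + β • b + γ • c = 0 → α = 0 ∧ β = 0 ∧ γ = 0 := by
  rw [← affineIndependent_iff_not_collinear_set, affineIndependent_iff_of_fintype]
  constructor
  · intro h α β γ hs hc
    have h0 : Finset.univ.weightedVSub ![a, b, c] ![α, β, γ] = (0 : Pt) := by
      rw [Finset.univ.weightedVSub_eq_linear_combination (by simpa [Fin.sum_univ_three] using hs)]
      simpa [Fin.sum_univ_three] using hc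
    have := h ![α, β, γ] (by simpa [Fin.sum_univ_three] using hs) h0
    exact ⟨this 0, this 1, this 2⟩
  · intro h w hs hc
    rw [Finset.univ.weightedVSub_eq_linear_combination hs] at hc
    obtain ⟨h0, h1, h2⟩ := h (w 0) (w 1) (w 2) (by simpa [Fin.sum_univ_three] using hs)
      (by simpa [Fin.sum_univ_three] using hc)
    intro i
    fin_cases i <;> assumption

lemma exists_bary (h : ¬ Collinear ℝ ({a, b, c} : Set Pt)) (y : Pt) :
    ∃ α β γ : ℝ, α + β + γ = 1 ∧ y = α • a + β • b + γ • c := by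
  rw [← affineIndependent_iff_not_collinear_set] at h
  have htop : affineSpan ℝ (Set.range ![a, b, c]) = ⊤ := by
    rw [h.affineSpan_eq_top_iff_card_eq_finrank_add_one]
    simp
  obtain ⟨w, hw, hy⟩ := eq_affineCombination_of_mem_affineSpan_of_fintype
    (p1 := y) (p := ![a, b, c]) (by rw [htop]; trivial)
  refine ⟨w 0, w 1, w 2, by simpa [Fin.sum_univ_three] using hw, ?_⟩
  rw [hy, Finset.affineCombination_eq_linear_combination _ _ _ hw]
  simp [Fin.sum_univ_three]

lemma bary_unique (h : ¬ Collinear ℝ ({a, b, c} : Set Pt)) {α β γ α' β' γ' : ℝ}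
    (hs : α + β + γ = 1) (hs' : α' + β' + γ' = 1)
    (he : α • a + β • b + γ • c = α' • a + β' • b + γ' • c) : α = α' ∧ β = β' ∧ γ = γ' := by
  obtain ⟨h1, h2, h3⟩ := not_collinear_iff_bary.1 h (α - α') (β - β') (γ - γ') (by linarith)
    (by linear_combination (norm := module) he)
  exact ⟨by linarith, by linarith, by linarith⟩

lemma mem_convexHull_triple_iff : x ∈ convexHull ℝ ({a, b, c} : Set Pt) ↔
    ∃ α β γ : ℝ, 0 ≤ α ∧ 0 ≤ β ∧ 0 ≤ γ ∧ α + β + γ = 1 ∧ x = α • a + β • b + γ • c := by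
  constructor
  · rw [convexHull_insert (by simp), convexHull_pair, mem_convexJoin]
    rintro ⟨p, rfl, q, ⟨s, t, hs, ht, hst, rfl⟩, ⟨s', t', hs', ht', hst', rfl⟩⟩
    refine ⟨s', t' * s, t' * t, hs', by positivity, by positivity, ?_, by module⟩
    linear_combination hst' + t' * hst
  · rintro ⟨α, β, γ, h1, h2, h3, hs, rfl⟩
    have hc := convex_convexHull ℝ ({a, b, c} : Set Pt)
    have hm : ∀ z ∈ ({a, b, c} : Set Pt), z ∈ convexHull ℝ ({a, b, c} : Set Pt) :=
      fun z hz => subset_convexHull ℝ _ hz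
    have := hc.sum_mem (t := Finset.univ) (w := ![α, β, γ]) (z := ![a, b, c])
      (by intro i _; fin_cases i <;> assumption) (by simpa [Fin.sum_univ_three] using hs)
      (by intro i _; fin_cases i <;> exact hm _ (by simp))
    simpa [Fin.sum_univ_three] using this

lemma not_mem_segment_of_bary (h : ¬ Collinear ℝ ({a, b, c} : Set Pt)) {α β γ : ℝ}
    (hα : α ≠ 0) (hs : α + β + γ = 1) : α • a + β • b + γ • c ∉ segment ℝ b c := by
  rintro ⟨s, t, -, -, hst, he⟩
  exact hα (bary_unique h hs (α' := 0) (β' := s) (γ' := t) (by linarith)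
    (by rw [← he]; module)).1

end Barycentric

section Triangles

variable {P : Set Pt} {T : Set (Sym2 Pt)} {a b c d x y u v : Pt}

lemma IsTriangleOf.rotate (h : IsTriangleOf P T a b c) : IsTriangleOf P T b c a := by
  have hs : ({b, c, a} : Set Pt) = {a, b, c} := by ext; simp; tauto
  obtain ⟨h1, h2, h3, h4, h5⟩ := h
  refine ⟨h2, Sym2.eq_swap ▸ h3, Sym2.eq_swap ▸ h1, hs ▸ h4, fun p hp hm => ?_⟩
  have := h5 p hp (hs ▸ hm)
  tauto

lemma IsTriangleOf.swap (h : IsTriangleOf P T a b c) : IsTriangleOf P T b a c := by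
  have hs : ({b, a, c} : Set Pt) = {a, b, c} := by ext; simp; tauto
  obtain ⟨h1, h2, h3, h4, h5⟩ := h
  refine ⟨Sym2.eq_swap ▸ h1, h3, h2, hs ▸ h4, fun p hp hm => ?_⟩
  have := h5 p hp (hs ▸ hm)
  tauto

lemma IsTriangleOf.mono {S : Set (Sym2 Pt)} (h : IsTriangleOf P T a b c)
    (hS : ∀ e, e ∈ T → EdgeOfTriangle e a b c → e ∈ S) : IsTriangleOf P S a b c :=
  ⟨hS _ h.1 (.inl rfl), hS _ h.2.1 (.inr (.inl rfl)), hS _ h.2.2.1 (.inr (.inr rfl)), h.2.2.2⟩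

lemma IsTriangleOf.mem (h : IsTriangleOf P T a b c) {e : Sym2 Pt}
    (he : EdgeOfTriangle e a b c) : e ∈ T := by
  obtain rfl | rfl | rfl := he
  exacts [h.1, h.2.1, h.2.2.1]

lemma ne_of_not_collinear (h : ¬ Collinear ℝ ({a, b, c} : Set Pt)) : a ≠ b ∧ b ≠ c ∧ a ≠ c := by
  refine ⟨?_, ?_, ?_⟩ <;> rintro rfl <;> apply h
  · simpa using collinear_pair ℝ a c
  · simpa using collinear_pair ℝ a b
  · simpa [Set.pair_comm] using collinear_pair ℝ b a

lemma ValidEdgeSet.no_crossing (hT : ValidEdgeSet P T) (h1 : s(a, b) ∈ T) (h2 : s(u, v) ∈ T)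
    (hne : s(a, b) ≠ s(u, v)) (hx : x ∈ segment ℝ a b) (hx' : x ∈ segment ℝ u v) :
    (x = a ∨ x = b) ∧ (x = u ∨ x = v) := by
  have := hT.2.2.1 _ h1 _ h2 hne x hx hx'
  simpa using this

lemma ValidEdgeSet.endpoint (hT : ValidEdgeSet P T) (h1 : s(a, b) ∈ T) (hx : x ∈ segment ℝ a b)
    (hP : x ∈ P) : x = a ∨ x = b := by
  have h2 : x ∉ openSegment ℝ a b := hT.2.2.2 _ h1 x hP
  rw [← insert_endpoints_openSegment] at hx
  simp only [Set.mem_insert_iff] at hx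
  tauto

lemma ValidEdgeSet.ne (hT : ValidEdgeSet P T) (h1 : s(a, b) ∈ T) : a ≠ b := by
  simpa using hT.1 _ h1

/-- Leaving a triangle through its edge `bc` forces a crossing. -/
lemma ValidEdgeSet.no_exit (hT : ValidEdgeSet P T) (hbc : s(b, c) ∈ T) (huv : s(u, v) ∈ T)
    (hnc : ¬ Collinear ℝ ({a, b, c} : Set Pt)) {α β γ α' β' γ' : ℝ}
    (hα : 0 < α) (hβ : 0 < β) (hγ : 0 < γ) (hs : α + β + γ = 1) (hs' : α' + β' + γ' = 1)
    (hx : α • a + β • b + γ • c ∈ segment ℝ u v) (hu : u = α' • a + β' • b + γ' • c)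
    (hneg : α' < 0) (h1 : α' / α ≤ β' / β) (h2 : α' / α ≤ γ' / γ) : False := by
  by_cases hne : s(u, v) = s(b, c)
  · refine not_mem_segment_of_bary hnc hα.ne' hs ?_
    have : segOf s(u, v) = segOf s(b, c) := by rw [hne]
    have hx' : _ ∈ segOf s(u, v) := hx
    rw [this] at hx'
    exact hx'
  obtain ⟨r, hr⟩ : ∃ r, r = α' / α := ⟨_, rfl⟩
  have hr0 : r < 0 := hr ▸ div_neg_of_neg_of_pos hneg hα
  have hrα : r * α = α' := by rw [hr]; field_simp
  have hrβ : r * β ≤ β' := by rw [hr]; rwa [le_div_iff₀ hβ] at h1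
  have hrγ : r * γ ≤ γ' := by rw [hr]; rwa [le_div_iff₀ hγ] at h2
  have hr1 : 0 < 1 - r := by linarith
  have hy : (1 - r)⁻¹ • (u - r • (α • a + β • b + γ • c)) ∈ segment ℝ b c := by
    refine ⟨(β' - r * β) / (1 - r), (γ' - r * γ) / (1 - r), div_nonneg (by linarith) hr1.le,
      div_nonneg (by linarith) hr1.le, ?_, ?_⟩
    · field_simp
      linear_combination hs' - r * hs + hrα
    · rw [hu, ← hrα]
      module
  obtain ⟨p, q, hp, hq, hpq, he⟩ := id hx
  have hpq' : 0 < 1 - r * p := by nlinarith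
  have hy' : (1 - r)⁻¹ • (u - r • (α • a + β • b + γ • c)) ∈ segment ℝ u v := by
    refine ⟨(1 - r * p) / (1 - r), (- r * q) / (1 - r), div_nonneg hpq'.le hr1.le,
      div_nonneg (by nlinarith) hr1.le, ?_, ?_⟩
    · field_simp
      linear_combination -r * hpq
    · rw [← he]
      module
  rcases (hT.no_crossing huv hbc hne hy' hy).1 with h | h
  · rw [inv_smul_eq_iff₀ hr1.ne'] at h
    have h3 : r • u = r • (α • a + β • b + γ • c) := by linear_combination (norm := module) h
    have h4 := smul_right_injective _ hr0.ne h3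
    have := (bary_unique hnc hs' hs (hu ▸ h4)).1
    linarith
  · rw [inv_smul_eq_iff₀ hr1.ne', ← he] at h
    have h3 : (1 - r * p) • u = (1 - r * p) • v := by
      obtain rfl : q = 1 - p := by linarith
      linear_combination (norm := module) h
    exact hT.ne huv (smul_right_injective _ hpq'.ne' h3)

lemma ValidEdgeSet.vertex_of_inner (hT : ValidEdgeSet P T) (ht : IsTriangleOf P T a b c)
    (huv : s(u, v) ∈ T) {α β γ : ℝ} (hα : 0 < α) (hβ : 0 < β) (hγ : 0 < γ) (hs : α + β + γ = 1)
    (hx : α • a + β • b + γ • c ∈ segment ℝ u v) : u = a ∨ u = b ∨ u = c := by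
  obtain ⟨α', β', γ', hs', hu⟩ := exists_bary ht.2.2.2.1 u
  by_cases hpos : 0 ≤ α' ∧ 0 ≤ β' ∧ 0 ≤ γ'
  · exact ht.2.2.2.2 u (hT.2.1 _ huv u (by simp))
      (mem_convexHull_triple_iff.2 ⟨α', β', γ', hpos.1, hpos.2.1, hpos.2.2, hs', hu⟩)
  exfalso
  have hneg : α' / α < 0 ∨ β' / β < 0 ∨ γ' / γ < 0 := by
    by_contra! h
    refine hpos ⟨?_, ?_, ?_⟩
    · simpa using (le_div_iff₀ hα).1 h.1
    · simpa using (le_div_iff₀ hβ).1 h.2.1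
    · simpa using (le_div_iff₀ hγ).1 h.2.2
  have neg_of {p q : ℝ} (hq : 0 < q) (h : p / q < 0) : p < 0 := by
    by_contra! h'
    exact absurd (div_nonneg h' hq.le) (not_le.2 h)
  have key : (α' / α ≤ β' / β ∧ α' / α ≤ γ' / γ) ∨ (β' / β ≤ γ' / γ ∧ β' / β ≤ α' / α) ∨
      (γ' / γ ≤ α' / α ∧ γ' / γ ≤ β' / β) := by grind
  have e1 : α • a + β • b + γ • c = β • b + γ • c + α • a := by module
  have e2 : α • a + β • b + γ • c = γ • c + α • a + β • b := by module
  have e1' : u = β' • b + γ' • c + α' • a := by rw [hu]; module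
  have e2' : u = γ' • c + α' • a + β' • b := by rw [hu]; module
  rcases key with ⟨h1, h2⟩ | ⟨h1, h2⟩ | ⟨h1, h2⟩
  · exact hT.no_exit ht.2.1 huv ht.2.2.2.1 hα hβ hγ hs hs' hx hu
      (neg_of hα (by grind)) h1 h2
  · have ht := ht.rotate
    exact hT.no_exit ht.2.1 huv ht.2.2.2.1 hβ hγ hα (by linarith) (by linarith) (e1 ▸ hx) e1'
      (neg_of hβ (by grind)) h1 h2
  · have ht := ht.rotate.rotate
    exact hT.no_exit ht.2.1 huv ht.2.2.2.1 hγ hα hβ (by linarith) (by linarith) (e2 ▸ hx) e2'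
      (neg_of hγ (by grind)) h1 h2

/-- No edge meets the interior of a triangle. -/
lemma ValidEdgeSet.not_mem_inner (hT : ValidEdgeSet P T) (ht : IsTriangleOf P T a b c)
    (huv : s(u, v) ∈ T) {α β γ : ℝ} (hα : 0 < α) (hβ : 0 < β) (hγ : 0 < γ) (hs : α + β + γ = 1) :
    α • a + β • b + γ • c ∉ segment ℝ u v := by
  intro hx
  have hu := hT.vertex_of_inner ht huv hα hβ hγ hs hx
  have hv := hT.vertex_of_inner ht (Sym2.eq_swap ▸ huv) hα hβ hγ hs (segment_symm ℝ u v ▸ hx)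
  have hne := hT.ne huv
  have h1 : α • a + β • b + γ • c ∉ segment ℝ b c :=
    not_mem_segment_of_bary ht.2.2.2.1 hα.ne' hs
  have h2 : α • a + β • b + γ • c ∉ segment ℝ c a := by
    have := not_mem_segment_of_bary (β := γ) (γ := α) ht.rotate.2.2.2.1 hβ.ne' (by linarith)
    rwa [show α • a + β • b + γ • c = β • b + γ • c + α • a by module]
  have h3 : α • a + β • b + γ • c ∉ segment ℝ a b := by
    have := not_mem_segment_of_bary (β := α) (γ := β) ht.rotate.rotate.2.2.2.1 hγ.ne' (by linarith)
    rwa [show α • a + β • b + γ • c = γ • c + α • a + β • b by module]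
  have h1' := segment_symm ℝ b c ▸ h1
  have h2' := segment_symm ℝ c a ▸ h2
  have h3' := segment_symm ℝ a b ▸ h3
  rcases hu with rfl | rfl | rfl <;> rcases hv with rfl | rfl | rfl <;> contradiction

end Triangles

section Quadrilaterals

variable {P : Set Pt} {T S : Set (Sym2 Pt)} {a b c d x y u v : Pt}

lemma ValidEdgeSet.no_shared_side_of_neg (hT : ValidEdgeSet P T) (hx : IsTriangleOf P T a c x)
    (hy : IsTriangleOf P T a c y) {α γ ξ : ℝ} (hs : α + γ + ξ = 1)
    (he : y = α • a + γ • c + ξ • x) (hξ : 0 < ξ) (hα : α < 0) (hγ : 0 ≤ γ) : False := by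
  obtain ⟨hac, hcx, hax⟩ := ne_of_not_collinear hx.2.2.2.1
  obtain ⟨-, hcy, hay⟩ := ne_of_not_collinear hy.2.2.2.1
  have hα1 : 0 < 1 - α := by linarith
  have h1 : (1 - α)⁻¹ • (y - α • a) ∈ segment ℝ a y := by
    refine ⟨-α / (1 - α), 1 / (1 - α), div_nonneg (by linarith) hα1.le, by positivity, ?_, ?_⟩
    · field_simp; ring
    · module
  have h2 : (1 - α)⁻¹ • (y - α • a) ∈ segment ℝ c x := by
    refine ⟨γ / (1 - α), ξ / (1 - α), div_nonneg hγ hα1.le, by positivity, ?_, ?_⟩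
    · field_simp; linarith
    · rw [he]; module
  have hne : s(a, y) ≠ s(c, x) := by simp [hac, hax]
  rcases (hT.no_crossing hy.2.2.1 hx.2.1 hne h1 h2).1 with h | h
  · rw [inv_smul_eq_iff₀ hα1.ne'] at h
    exact hay (by linear_combination (norm := module) -h)
  · rw [inv_smul_eq_iff₀ hα1.ne'] at h
    have : α • a = α • y := by linear_combination (norm := module) -h
    exact hay (smul_right_injective _ hα.ne this)

/-- There is at most one triangle on each side of an edge. -/
lemma ValidEdgeSet.third_vertex_unique (hT : ValidEdgeSet P T) (hx : IsTriangleOf P T a c x)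
    (hy : IsTriangleOf P T a c y) {α γ ξ : ℝ} (hs : α + γ + ξ = 1)
    (he : y = α • a + γ • c + ξ • x) (hξ : 0 < ξ) : y = x := by
  obtain ⟨hac, hcx, hax⟩ := ne_of_not_collinear hx.2.2.2.1
  obtain ⟨-, hcy, hay⟩ := ne_of_not_collinear hy.2.2.2.1
  rcases lt_or_ge α 0 with hα | hα <;> rcases lt_or_ge γ 0 with hγ | hγ
  · have hm : x ∈ convexHull ℝ ({a, c, y} : Set Pt) := by
      refine mem_convexHull_triple_iff.2 ⟨-α / ξ, -γ / ξ, 1 / ξ, div_nonneg (by linarith) hξ.le,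
        div_nonneg (by linarith) hξ.le, by positivity, ?_, ?_⟩
      · field_simp; linarith
      · rw [he]; match_scalars <;> field_simp <;> ring
    have := hy.2.2.2.2 x (hT.2.1 _ hx.2.1 x (by simp)) hm
    grind
  · exact (hT.no_shared_side_of_neg hx hy hs he hξ hα hγ).elim
  · exact (hT.no_shared_side_of_neg hx.swap hy.swap (α := γ) (γ := α) (by linarith)
      (by rw [he]; module) hξ hγ hα).elim
  · have hm : y ∈ convexHull ℝ ({a, c, x} : Set Pt) :=
      mem_convexHull_triple_iff.2 ⟨α, γ, ξ, hα, hγ, hξ.le, hs, he⟩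
    have := hx.2.2.2.2 y (hT.2.1 _ hy.2.1 y (by simp)) hm
    grind

lemma bary_ne_zero (h : ¬ Collinear ℝ ({a, c, y} : Set Pt)) {α γ ξ : ℝ} (hs : α + γ + ξ = 1)
    (he : y = α • a + γ • c + ξ • x) : ξ ≠ 0 := by
  rintro rfl
  have := not_collinear_iff_bary.1 h α γ (-1) (by linarith) (by rw [he]; module)
  linarith [this.2.2]

/-- Two triangles on a common edge lie on different sides of it. -/
lemma ValidEdgeSet.third_vertex_opposite (hT : ValidEdgeSet P T) (hx : IsTriangleOf P T a c x)
    (hy : IsTriangleOf P T a c y) (hxy : x ≠ y) {α γ ξ : ℝ} (hs : α + γ + ξ = 1)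
    (he : y = α • a + γ • c + ξ • x) : ξ < 0 := by
  rcases lt_trichotomy ξ 0 with h | h | h
  · exact h
  · exact (bary_ne_zero hy.2.2.2.1 hs he h).elim
  · exact (hxy (hT.third_vertex_unique hx hy hs he h).symm).elim

/-- An edge is incident to at most two triangles. -/
lemma ValidEdgeSet.third_vertex_eq_or_eq (hT : ValidEdgeSet P T) (hb : IsTriangleOf P T a c b)
    (hd : IsTriangleOf P T a c d) (hbd : b ≠ d) (hx : IsTriangleOf P T a c x) :
    x = b ∨ x = d := by
  by_contra! hne
  obtain ⟨α, γ, β, hs, he⟩ := exists_bary hb.2.2.2.1 d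
  obtain ⟨α', γ', β', hs', he'⟩ := exists_bary hb.2.2.2.1 x
  have hβ := hT.third_vertex_opposite hb hd hbd hs he
  have hβ' := hT.third_vertex_opposite hb hx hne.1.symm hs' he'
  have hβ0 := hβ.ne
  refine hne.2 (hT.third_vertex_unique hd hx (α := α' - β' / β * α) (γ := γ' - β' / β * γ)
    (ξ := β' / β) ?_ ?_ (div_pos_of_neg_of_neg hβ' hβ))
  · have : β' / β * β = β' := div_mul_cancel₀ _ hβ.ne
    linear_combination hs' - β' / β * hs + this
  · rw [he, he']
    match_scalars <;> field_simp <;> ring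

lemma ShareTriangle.exists_third {e : Sym2 Pt} (h : ShareTriangle P T e s(a, c)) :
    ∃ x, IsTriangleOf P T a c x ∧ EdgeOfTriangle e a c x := by
  obtain ⟨p, q, r, ht, he, hac⟩ := h
  unfold EdgeOfTriangle at he hac ⊢
  simp only [Sym2.eq_iff] at hac
  rcases hac with (⟨rfl, rfl⟩ | ⟨rfl, rfl⟩) | (⟨rfl, rfl⟩ | ⟨rfl, rfl⟩) | ⟨rfl, rfl⟩ | ⟨rfl, rfl⟩
  · exact ⟨r, ht, he⟩
  · exact ⟨r, ht.swap, by grind [Sym2.eq_swap]⟩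
  · exact ⟨p, ht.rotate, by grind [Sym2.eq_swap]⟩
  · exact ⟨p, ht.rotate.swap, by grind [Sym2.eq_swap]⟩
  · exact ⟨q, ht.rotate.rotate.swap, by grind [Sym2.eq_swap]⟩
  · exact ⟨q, ht.rotate.rotate, by grind [Sym2.eq_swap]⟩

lemma ShareTriangle.edge_of_quad {e : Sym2 Pt} (h : ShareTriangle P T e s(a, c))
    (hT : ValidEdgeSet P T) (hq : IsFlipQuad P T a b c d) :
    EdgeOfTriangle e a b c ∨ EdgeOfTriangle e a c d := by
  obtain ⟨x, hx, he⟩ := h.exists_third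
  rcases hT.third_vertex_eq_or_eq hq.1.rotate.rotate.swap hq.2.1 hq.2.2.1 hx with rfl | rfl
  · left
    unfold EdgeOfTriangle at he ⊢
    grind [Sym2.eq_swap]
  · exact .inr he

/-- The segments `ac` and `bd` are the diagonals of a convex quadrilateral. -/
def Crosses (a b c d : Pt) : Prop :=
  ¬ Collinear ℝ ({a, b, c} : Set Pt) ∧ ∃ s t : ℝ, 0 < s ∧ s < 1 ∧ 0 < t ∧ t < 1 ∧
    (1 - s) • a + s • c = (1 - t) • b + t • d

lemma Crosses.reverse (h : Crosses a b c d) : Crosses c b a d := by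
  obtain ⟨hn, s, t, hs, hs', ht, ht', he⟩ := h
  refine ⟨?_, 1 - s, t, by linarith, by linarith, ht, ht', by rw [← he]; module⟩
  rwa [show ({c, b, a} : Set Pt) = {a, b, c} by ext; simp; tauto]

lemma Crosses.rotate (h : Crosses a b c d) : Crosses b c d a := by
  obtain ⟨hn, s, t, hs, hs', ht, ht', he⟩ := h
  refine ⟨?_, t, 1 - s, by linarith, by linarith, by linarith, by linarith, ?_⟩
  · refine not_collinear_iff_bary.2 fun α β γ h0 h1 => ?_
    have hd : d = t⁻¹ • ((1 - s) • a + s • c - (1 - t) • b) := by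
      rw [eq_inv_smul_iff₀ ht.ne', he]; module
    obtain ⟨e1, e2, e3⟩ := not_collinear_iff_bary.1 hn (γ * (1 - s) / t) (α - γ * (1 - t) / t)
      (β + γ * s / t) (by field_simp; linear_combination t * h0) (by
        rw [← h1, hd]; match_scalars <;> field_simp <;> ring)
    have hγ : γ = 0 := by
      have : 1 - s ≠ 0 := by linarith
      simp only [div_eq_zero_iff, mul_eq_zero] at e1
      have := ht.ne'
      tauto
    subst hγ
    exact ⟨by simpa using e2, by simpa using e3, rfl⟩
  · rw [← he]; module

lemma Crosses.ne (h : Crosses a b c d) : a ≠ b ∧ b ≠ c ∧ c ≠ d ∧ d ≠ a ∧ a ≠ c ∧ b ≠ d := by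
  obtain ⟨h1, h2, h3⟩ := ne_of_not_collinear h.1
  obtain ⟨-, h5, h6⟩ := ne_of_not_collinear h.rotate.1
  obtain ⟨-, h8, -⟩ := ne_of_not_collinear h.rotate.rotate.1
  exact ⟨h1, h2, h5, h8, h3, h6⟩

lemma IsFlipQuad.crosses (hT : ValidEdgeSet P T) (hq : IsFlipQuad P T a b c d) :
    Crosses a b c d := by
  obtain ⟨habc, hacd, hbd, hconv⟩ := hq
  obtain ⟨hab, hbc, hac⟩ := ne_of_not_collinear habc.2.2.2.1
  obtain ⟨-, hcd, had⟩ := ne_of_not_collinear hacd.2.2.2.1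
  have hacb := habc.rotate.rotate.swap
  obtain ⟨α, γ, β, hs, he⟩ := exists_bary hacb.2.2.2.1 d
  have hβ := hT.third_vertex_opposite hacb hacd hbd hs he
  have hα : 0 < α := by
    by_contra! hα
    refine hconv c (by simp) ?_
    rw [show ({a, b, c, d} : Set Pt) \ {c} = {a, b, d} by ext; simp; grind]
    have hγ : 0 < γ := by linarith
    refine mem_convexHull_triple_iff.2 ⟨-α / γ, -β / γ, 1 / γ, div_nonneg (by linarith) hγ.le,
      div_nonneg (by linarith) hγ.le, by positivity, ?_, ?_⟩
    · field_simp; linarith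
    · rw [he]; match_scalars <;> field_simp <;> ring
  have hγ : 0 < γ := by
    by_contra! hγ
    refine hconv a (by simp) ?_
    rw [show ({a, b, c, d} : Set Pt) \ {a} = {b, c, d} by ext; simp; grind]
    refine mem_convexHull_triple_iff.2 ⟨-β / α, -γ / α, 1 / α, div_nonneg (by linarith) hα.le,
      div_nonneg (by linarith) hα.le, by positivity, ?_, ?_⟩
    · field_simp; linarith
    · rw [he]; match_scalars <;> field_simp <;> ring
  have h1 : 0 < 1 - β := by linarith
  refine ⟨habc.2.2.2.1, γ / (1 - β), 1 / (1 - β), by positivity, ?_, by positivity, ?_, ?_⟩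
  · rw [div_lt_one h1]; linarith
  · rw [div_lt_one h1]; linarith
  · obtain rfl : α = 1 - γ - β := by linarith
    rw [he]
    match_scalars <;> field_simp <;> ring

lemma Crosses.openSegment_cases (h : Crosses a b c d) (hx : x ∈ openSegment ℝ a c) :
    x ∈ openSegment ℝ b d ∨
    (∃ α β γ : ℝ, 0 < α ∧ 0 < β ∧ 0 < γ ∧ α + β + γ = 1 ∧ x = α • a + β • b + γ • d) ∨
    (∃ α β γ : ℝ, 0 < α ∧ 0 < β ∧ 0 < γ ∧ α + β + γ = 1 ∧ x = α • b + β • c + γ • d) := by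
  obtain ⟨-, s, t, hs, hs', ht, ht', he⟩ := h
  obtain ⟨q, r, hq, hr, hqr, rfl⟩ := hx
  obtain rfl : q = 1 - r := by linarith
  have hs1 : 0 < 1 - s := by linarith
  have ht1 : 0 < 1 - t := by linarith
  rcases lt_trichotomy r s with h | rfl | h
  · right; left
    have h2 : 0 < s - r := by linarith
    refine ⟨(s - r) / s, r / s * (1 - t), r / s * t, by positivity, by positivity,
      by positivity, by field_simp; ring, ?_⟩
    have h3 : (r / s) • ((1 - s) • a + s • c) = (r / s) • ((1 - t) • b + t • d) := by rw [he]
    have h4 : r / s * s = r := by field_simp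
    have h5 : (s - r) / s = 1 - r / s := by field_simp
    rw [h5]
    generalize r / s = k at *
    subst h4
    linear_combination (norm := module) h3
  · left
    exact ⟨1 - t, t, ht1, ht, by ring, he.symm⟩
  · right; right
    have h2 : 0 < r - s := by linarith
    refine ⟨(1 - r) / (1 - s) * (1 - t), (r - s) / (1 - s), (1 - r) / (1 - s) * t, by positivity,
      by positivity, by positivity, by field_simp; ring, ?_⟩
    have h3 : ((1 - r) / (1 - s)) • ((1 - s) • a + s • c) =
      ((1 - r) / (1 - s)) • ((1 - t) • b + t • d) := by rw [he]
    have h4 : r = 1 - (1 - r) / (1 - s) * (1 - s) := by field_simp; ring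
    have h5 : (r - s) / (1 - s) = 1 - (1 - r) / (1 - s) := by field_simp; ring
    rw [h5]
    generalize (1 - r) / (1 - s) = k at *
    subst h4
    linear_combination (norm := module) h3

lemma not_mem_openSegment_left (h : a ≠ b) : a ∉ openSegment ℝ a b := by
  rwa [left_mem_openSegment_iff]

lemma not_mem_openSegment_right (h : a ≠ b) : b ∉ openSegment ℝ a b := by
  rwa [right_mem_openSegment_iff]

/-- Only the diagonal `bd` can cross the diagonal `ac`. -/
lemma ValidEdgeSet.eq_of_mem_diagonal (hT : ValidEdgeSet P T) (hc : Crosses a b c d)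
    (h1 : IsTriangleOf P T a b d) (h2 : IsTriangleOf P T b c d) (huv : s(u, v) ∈ T)
    (hx : x ∈ openSegment ℝ a c) (hx' : x ∈ segment ℝ u v) : s(u, v) = s(b, d) := by
  by_contra hne
  rcases hc.openSegment_cases hx with h | ⟨α, β, γ, hα, hβ, hγ, hs, rfl⟩ |
    ⟨α, β, γ, hα, hβ, hγ, hs, rfl⟩
  · have hbd := hc.ne.2.2.2.2.2
    rcases (hT.no_crossing h1.2.1 huv (Ne.symm hne) (openSegment_subset_segment _ _ _ h) hx').1
      with rfl | rfl
    · exact not_mem_openSegment_left hbd h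
    · exact not_mem_openSegment_right hbd h
  · exact hT.not_mem_inner h1 huv hα hβ hγ hs hx'
  · exact hT.not_mem_inner h2 huv hα hβ hγ hs hx'

lemma Crosses.not_both_mem (hc : Crosses a b c d) (hT : ValidEdgeSet P T) (h1 : s(a, c) ∈ T)
    (h2 : s(b, d) ∈ T) : False := by
  obtain ⟨hab, hbc, hcd, hda, hac, hbd⟩ := hc.ne
  obtain ⟨-, s, t, hs, hs', ht, ht', he⟩ := hc
  have hm : (1 - s) • a + s • c ∈ openSegment ℝ a c := ⟨1 - s, s, by linarith, hs, by ring, rfl⟩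
  have hm' : (1 - s) • a + s • c ∈ segment ℝ b d :=
    ⟨1 - t, t, by linarith, ht.le, by ring, he.symm⟩
  have hne : s(a, c) ≠ s(b, d) := by simp [hab, hda.symm]
  rcases (hT.no_crossing h1 h2 hne (openSegment_subset_segment _ _ _ hm) hm').1 with h | h <;>
    rw [h] at hm
  · exact not_mem_openSegment_left hac hm
  · exact not_mem_openSegment_right hac hm

lemma Crosses.triangle (hc : Crosses a b c d) (h1 : IsTriangleOf P T a b c)
    (h2 : IsTriangleOf P T a c d) (hab : s(a, b) ∈ S) (hbd : s(b, d) ∈ S) (had : s(a, d) ∈ S) :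
    IsTriangleOf P S a b d := by
  have hnc : ¬ Collinear ℝ ({a, b, d} : Set Pt) := by
    rw [show ({a, b, d} : Set Pt) = {d, a, b} by ext; simp; tauto]
    exact hc.rotate.rotate.rotate.1
  refine ⟨hab, hbd, had, hnc, fun p hp hm => ?_⟩
  obtain ⟨-, s, t, hs, hs', ht, ht', he⟩ := hc
  have hs1 : 0 < 1 - s := by linarith
  have ht1 : 0 < 1 - t := by linarith
  obtain ⟨l, m, n, hl, hm', hn, hsum, hpe⟩ := mem_convexHull_triple_iff.1 hm
  have hpc : p ≠ c := by
    rintro rfl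
    have h3 := bary_unique hnc (α := -(1 - s) / s) (β := (1 - t) / s) (γ := t / s)
      (by field_simp; ring) hsum (by
        rw [← hpe, eq_comm, ← inv_smul_smul₀ hs.ne' p,
          show s • p = (1 - t) • b + t • d - (1 - s) • a by rw [← he]; module]
        module)
    have h4 : -(1 - s) / s < 0 := div_neg_of_neg_of_pos (by linarith) hs
    linarith [h3.1]
  rcases le_total (n * (1 - t)) (m * t) with h | h
  · have h3 := h1.2.2.2.2 p hp (mem_convexHull_triple_iff.2 ⟨l + n / t * (1 - s),
      (m * t - n * (1 - t)) / t, n / t * s, by positivity,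
      div_nonneg (by linarith) ht.le, by positivity, by field_simp; linear_combination t * hsum, ?_⟩)
    · tauto
    · have h3 : (n / t) • ((1 - s) • a + s • c) = (n / t) • ((1 - t) • b + t • d) := by rw [he]
      have h5 : (m * t - n * (1 - t)) / t = m - n / t * (1 - t) := by field_simp
      have h4 : n = n / t * t := by field_simp
      rw [hpe, h5]
      generalize n / t = k at *
      subst h4
      linear_combination (norm := module) -h3
  · have h3 := h2.2.2.2.2 p hp (mem_convexHull_triple_iff.2 ⟨l + m / (1 - t) * (1 - s),
      m / (1 - t) * s, (n * (1 - t) - m * t) / (1 - t), by positivity, by positivity,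
      div_nonneg (by linarith) ht1.le, by field_simp; linear_combination (1 - t) * hsum, ?_⟩)
    · tauto
    · have h3 : (m / (1 - t)) • ((1 - s) • a + s • c) = (m / (1 - t)) • ((1 - t) • b + t • d) := by
        rw [he]
      have h5 : (n * (1 - t) - m * t) / (1 - t) = n - m / (1 - t) * t := by field_simp
      have h4 : m = m / (1 - t) * (1 - t) := by field_simp
      rw [hpe, h5]
      generalize m / (1 - t) = k at *
      subst h4
      linear_combination (norm := module) -h3

end Quadrilaterals

section Flips

variable {P : Set Pt} {T T' S : Set (Sym2 Pt)} {a b c d : Pt} {f g : FlipData}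

/-- The edge set obtained by performing the flip `f`. -/
def flipStep (T : Set (Sym2 Pt)) (f : FlipData) : Set (Sym2 Pt) := (T \ {f.1}) ∪ {f.2}

lemma mem_flipStep {e : Sym2 Pt} : e ∈ flipStep T f ↔ (e ∈ T ∧ e ≠ f.1) ∨ e = f.2 := by
  simp [flipStep, or_comm]

lemma Crosses.triangles_flipStep (hc : Crosses a b c d) (h1 : IsTriangleOf P T a b c)
    (h2 : IsTriangleOf P T a c d) (hS : flipStep T (s(a, c), s(b, d)) ⊆ S) :
    IsTriangleOf P S a b d ∧ IsTriangleOf P S b c d := by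
  obtain ⟨hab, hbc, hcd, hda, hac, hbd⟩ := hc.ne
  have hSm {e : Sym2 Pt} (he : e ∈ T) (hne : e ≠ s(a, c)) : e ∈ S :=
    hS (mem_flipStep.2 (.inl ⟨he, hne⟩))
  have hbdS : s(b, d) ∈ S := hS (mem_flipStep.2 (.inr rfl))
  have e1 : s(a, b) ∈ S := hSm h1.1 (by simp; grind)
  have e2 : s(b, c) ∈ S := hSm h1.2.1 (by simp; grind)
  have e3 : s(c, d) ∈ S := hSm h2.2.1 (by simp; grind)
  have e4 : s(a, d) ∈ S := hSm h2.2.2.1 (by simp; grind)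
  exact ⟨hc.triangle h1 h2 e1 hbdS e4, (hc.reverse.triangle h1.rotate.swap h2.swap
    (Sym2.eq_swap ▸ e2) hbdS e3).swap⟩

lemma ValidEdgeSet.flipStep (hT : ValidEdgeSet P T) (hq : IsFlipQuad P T a b c d) :
    ValidEdgeSet P (flipStep T (s(a, c), s(b, d))) := by
  have hc := hq.crosses hT
  obtain ⟨hab, hbc, hcd, hda, hac, hbd⟩ := hc.ne
  have hbP : b ∈ P := hT.2.1 _ hq.1.1 b (by simp)
  have hdP : d ∈ P := hT.2.1 _ hq.2.1.2.1 d (by simp)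
  have h1 := (hc.triangles_flipStep hq.1 hq.2.1 subset_rfl).1
  have key : ∀ e ∈ T, e ≠ s(a, c) → ∀ x, x ∈ segOf e → x ∈ segOf s(b, d) →
      x ∈ e ∧ x ∈ s(b, d) := by
    intro e
    induction e using Sym2.ind with | _ u v
    intro he hne x hx (hx' : x ∈ segment ℝ b d)
    by_cases ho : x ∈ openSegment ℝ b d
    · have := hT.eq_of_mem_diagonal hc.rotate hq.1.rotate hq.2.1.rotate he ho hx
      exact (hne (this.trans Sym2.eq_swap)).elim
    · rw [← insert_endpoints_openSegment] at hx'
      have hx2 : x = b ∨ x = d := by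
        simp only [Set.mem_insert_iff] at hx'
        tauto
      have hxP : x ∈ P := by rcases hx2 with rfl | rfl <;> assumption
      exact ⟨by simpa using hT.endpoint he hx hxP, by simpa using hx2⟩
  refine ⟨?_, ?_, ?_, ?_⟩
  · intro e he
    rcases mem_flipStep.1 he with ⟨he, -⟩ | rfl
    · exact hT.1 e he
    · simpa using hbd
  · intro e he x hx
    rcases mem_flipStep.1 he with ⟨he, -⟩ | rfl
    · exact hT.2.1 e he x hx
    · rcases Sym2.mem_iff.1 hx with rfl | rfl <;> assumption
  · intro e he e' he' hne x hx hx'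
    rcases mem_flipStep.1 he with ⟨he, h⟩ | rfl <;> rcases mem_flipStep.1 he' with ⟨he', h'⟩ | rfl
    · exact hT.2.2.1 e he e' he' hne x hx hx'
    · exact key e he h x hx hx'
    · exact (key e' he' h' x hx' hx).symm
    · exact (hne rfl).elim
  · intro e he p hp
    rcases mem_flipStep.1 he with ⟨he, -⟩ | rfl
    · exact hT.2.2.2 e he p hp
    · intro (hm : p ∈ openSegment ℝ b d)
      have hm' : p ∈ convexHull ℝ ({a, b, d} : Set Pt) := by
        obtain ⟨s, t, hs, ht, hst, rfl⟩ := hm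
        exact mem_convexHull_triple_iff.2 ⟨0, s, t, le_rfl, hs.le, ht.le, by linarith, by module⟩
      rcases h1.2.2.2.2 p hp hm' with rfl | rfl | rfl
      · have := not_mem_segment_of_bary h1.2.2.2.1 one_ne_zero (β := 0) (γ := 0) (by norm_num)
        exact this (by simpa using openSegment_subset_segment _ _ _ hm)
      · exact not_mem_openSegment_left hbd hm
      · exact not_mem_openSegment_right hbd hm

/-- Flipping the diagonal of a convex quadrilateral of a triangulation gives a triangulation. -/
lemma IsTriangulation.flipStep (hT : IsTriangulation P T) (hq : IsFlipQuad P T a b c d) :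
    IsTriangulation P (flipStep T (s(a, c), s(b, d))) := by
  refine ⟨hT.1.flipStep hq, fun S hS hsub => ?_⟩
  have hc := hq.crosses hT.1
  obtain ⟨h1, h2⟩ := hc.triangles_flipStep hq.1 hq.2.1 hsub
  refine Set.Subset.antisymm (fun g hg => ?_) hsub
  by_contra hgT
  rw [mem_flipStep] at hgT
  push Not at hgT
  obtain ⟨hgT, hgbd⟩ := hgT
  have hgac : g ≠ s(a, c) := by
    rintro rfl
    exact hc.not_both_mem hS hg h1.2.1
  have hgT : g ∉ T := fun h => hgac (hgT h)
  have key : ∀ x, x ∈ segOf g → x ∈ segOf s(a, c) → x ∈ g ∧ x ∈ s(a, c) := by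
    induction g using Sym2.ind with | _ u v
    intro x hx (hx' : x ∈ segment ℝ a c)
    by_cases ho : x ∈ openSegment ℝ a c
    · exact (hgbd (hS.eq_of_mem_diagonal hc h1 h2 hg ho hx)).elim
    · rw [← insert_endpoints_openSegment] at hx'
      have hx2 : x = a ∨ x = c := by
        simp only [Set.mem_insert_iff] at hx'
        tauto
      have hxP : x ∈ P := hT.1.2.1 _ hq.1.2.2.1 x (by simpa using hx2)
      exact ⟨by simpa using hS.endpoint hg hx hxP, by simpa using hx2⟩
  have hsub' : ∀ e ∈ T, e ≠ s(a, c) → e ∈ S := fun e he hne => hsub (mem_flipStep.2 (.inl ⟨he, hne⟩))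
  have hval : ValidEdgeSet P (insert g T) := by
    refine ⟨?_, ?_, ?_, ?_⟩
    · rintro e (rfl | he)
      exacts [hS.1 _ hg, hT.1.1 _ he]
    · rintro e (rfl | he)
      exacts [hS.2.1 _ hg, hT.1.2.1 _ he]
    · have hge : ∀ e ∈ T, ∀ x, x ∈ segOf g → x ∈ segOf e → x ∈ g ∧ x ∈ e := by
        intro e he x hx hx'
        by_cases hne : e = s(a, c)
        · subst hne
          exact key x hx hx'
        · exact hS.2.2.1 _ hg _ (hsub' e he hne) (by rintro rfl; exact hgT he) x hx hx'
      rintro e (rfl | he) e' (rfl | he') hne x hx hx'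
      · exact (hne rfl).elim
      · exact hge e' he' x hx hx'
      · exact (hge e he x hx' hx).symm
      · exact hT.1.2.2.1 _ he _ he' hne x hx hx'
    · rintro e (rfl | he)
      exacts [hS.2.2.2 _ hg, hT.1.2.2.2 _ he]
  exact hgT (hT.2 _ hval (Set.subset_insert _ _) ▸ Set.mem_insert g T)

lemma FlipsTo.eq_flipStep (h : FlipsTo P T T' f) : T' = flipStep T f := by
  obtain ⟨-, -, a, b, c, d, -, -, -, h⟩ := h
  exact h

lemma FlipsTo.isTriangulation (h : FlipsTo P T T' f) : IsTriangulation P T' := by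
  obtain ⟨hT, -, a, b, c, d, hq, h1, h2, rfl⟩ := h
  rw [h1, h2]
  exact hT.flipStep hq

/-- The new edge of `f` is neither the edge flipped by `g` nor in a common triangle with it. -/
def Independent (P : Set Pt) (T : Set (Sym2 Pt)) (f g : FlipData) : Prop :=
  f.2 ≠ g.1 ∧ ¬ ShareTriangle P (flipStep T f) f.2 g.1

lemma IsTriangleOf.flipStep (h : IsTriangleOf P T a b c) (hf : ¬ EdgeOfTriangle f.1 a b c) :
    IsTriangleOf P (flipStep T f) a b c :=
  h.mono fun _ he hE => mem_flipStep.2 (.inl ⟨he, fun h => hf (h ▸ hE)⟩)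

lemma IsTriangleOf.of_flipStep (h : IsTriangleOf P (_root_.flipStep T f) a b c)
    (hf : ¬ EdgeOfTriangle f.2 a b c) : IsTriangleOf P T a b c :=
  h.mono fun e he hE => by
    rcases mem_flipStep.1 he with h | h
    · exact h.1
    · exact (hf (h ▸ hE)).elim

lemma edgeOfTriangle_left : EdgeOfTriangle s(a, b) a b c := .inl rfl

lemma edgeOfTriangle_right : EdgeOfTriangle s(a, c) a b c := .inr (.inr rfl)

/-- The quadrilateral of a flip independent of the preceding one exists before the latter. -/
lemma Independent.isFlipQuad (hi : Independent P T f g)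
    (hq : IsFlipQuad P (flipStep T f) a b c d) (hg : g.1 = s(a, c)) : IsFlipQuad P T a b c d :=
  ⟨hq.1.of_flipStep fun h => hi.2 ⟨a, b, c, hq.1, h, hg ▸ edgeOfTriangle_right⟩,
    hq.2.1.of_flipStep fun h => hi.2 ⟨a, c, d, hq.2.1, h, hg ▸ edgeOfTriangle_left⟩, hq.2.2⟩

lemma Independent.isFlipQuad_flipStep (hi : Independent P T f g) (hT : ValidEdgeSet P T)
    (hq : IsFlipQuad P T a b c d) (hf : f = (s(a, c), s(b, d))) (hne : g.1 ≠ s(a, c)) :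
    IsFlipQuad P (flipStep T g) a b c d := by
  subst hf
  obtain ⟨h1, h2⟩ := (hq.crosses hT).triangles_flipStep hq.1 hq.2.1 subset_rfl
  have hi1 : ¬ EdgeOfTriangle g.1 a b d := fun h => hi.2 ⟨a, b, d, h1, .inr (.inl rfl), h⟩
  have hi2 : ¬ EdgeOfTriangle g.1 b c d := fun h => hi.2 ⟨b, c, d, h2, .inr (.inr rfl), h⟩
  unfold EdgeOfTriangle at hi1 hi2
  exact ⟨hq.1.flipStep (by unfold EdgeOfTriangle; tauto),
    hq.2.1.flipStep (by unfold EdgeOfTriangle; tauto), hq.2.2⟩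

lemma FlipsTo.fst_notMem (hf : FlipsTo P T T' f) : f.1 ∉ T' := by
  obtain ⟨hT, -, a, b, c, d, hq, h1, h2, rfl⟩ := hf
  have := (hq.crosses hT.1).ne
  rw [h1, h2, ← _root_.flipStep.eq_1 T (s(a, c), s(b, d)), mem_flipStep]
  simp
  grind

/-- Independent consecutive flips can be interchanged. -/
lemma Independent.swap (hi : Independent P T f g) (hf : FlipsTo P T (flipStep T f) f)
    (hg : FlipsTo P (flipStep T f) (flipStep (flipStep T f) g) g) :
    FlipsTo P T (flipStep T g) g ∧ FlipsTo P (flipStep T g) (flipStep (flipStep T g) f) f ∧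
      flipStep (flipStep T g) f = flipStep (flipStep T f) g := by
  have hS := hg.isTriangulation
  have hfn := hf.fst_notMem
  obtain ⟨hT, hfT, a, b, c, d, hq, h1, h2, -⟩ := hf
  obtain ⟨hT', hgT, a', b', c', d', hq', h1', h2', -⟩ := hg
  have hne : g.1 ≠ f.1 := fun h => hfn (h ▸ hgT)
  have hgT0 : g.1 ∈ T := by
    rcases mem_flipStep.1 hgT with h | h
    · exact h.1
    · exact (hi.1 h.symm).elim
  have hq'' := hi.isFlipQuad hq' h1'
  have hTg : FlipsTo P T (flipStep T g) g := ⟨hT, hgT0, a', b', c', d', hq'', h1', h2', rfl⟩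
  have hgf : g.2 ≠ f.1 := by
    intro h
    refine (hq.crosses hT.1).not_both_mem hS.1 (?_ : s(a, c) ∈ _) (?_ : s(b, d) ∈ _)
    · exact mem_flipStep.2 (.inr (by rw [h, h1]))
    · exact mem_flipStep.2 (.inl ⟨mem_flipStep.2 (.inr h2.symm), h2 ▸ hi.1⟩)
  refine ⟨hTg, ⟨hTg.isTriangulation, mem_flipStep.2 (.inl ⟨hfT, hne.symm⟩), a, b, c, d,
    hi.isFlipQuad_flipStep hT.1 hq (Prod.ext h1 h2) (h1 ▸ hne), h1, h2, rfl⟩, ?_⟩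
  ext e
  have := hi.1
  simp only [mem_flipStep]
  grind

/-- Edges sharing a triangle with the edge of the second of two independent flips. -/
lemma Independent.shareTriangle_flipStep (hi : Independent P T f g)
    (hf : FlipsTo P T (flipStep T f) f) (hg : FlipsTo P (flipStep T f) T' g) {e : Sym2 Pt}
    (he : ShareTriangle P T e g.1) : e ≠ f.1 ∧ ShareTriangle P (flipStep T f) e g.1 := by
  have hfn := hf.fst_notMem
  obtain ⟨-, -, a, b, c, d, hq, h1, -, -⟩ := hg
  rw [h1] at he ⊢
  rcases he.edge_of_quad hf.1.1 (hi.isFlipQuad hq h1) with h | h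
  · exact ⟨fun h' => hfn (h' ▸ hq.1.mem h), a, b, c, hq.1, h, edgeOfTriangle_right⟩
  · exact ⟨fun h' => hfn (h' ▸ hq.2.1.mem h), a, c, d, hq.2.1, h, edgeOfTriangle_left⟩

/-- Edges sharing a triangle with the edge of the first of two independent flips. -/
lemma Independent.shareTriangle_of_flipStep (hi : Independent P T f g)
    (hf : FlipsTo P T (flipStep T f) f) (hg : FlipsTo P (flipStep T f) T' g) {e : Sym2 Pt}
    (he : ShareTriangle P (flipStep T g) e f.1) : ShareTriangle P T e f.1 := by
  have hg' := hg
  rw [hg.eq_flipStep] at hg'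
  have hne : g.1 ≠ f.1 := fun h => hf.fst_notMem (h ▸ hg.2.1)
  have hS := ((hi.swap hf hg').1).isTriangulation
  obtain ⟨hT, -, a, b, c, d, hq, h1, h2, -⟩ := hf
  rw [h1] at he ⊢
  rcases he.edge_of_quad hS.1
    (hi.isFlipQuad_flipStep hT.1 hq (Prod.ext h1 h2) (h1 ▸ hne)) with h | h
  · exact ⟨a, b, c, hq.1, h, edgeOfTriangle_right⟩
  · exact ⟨a, c, d, hq.2.1, h, edgeOfTriangle_left⟩

end Flips

section LabelledSequences

variable {P : Set Pt} {T Tr : Set (Sym2 Pt)}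

/-- The edge `e`, created by a flip labelled `ℓ`, has an arc only to flips of larger label. -/
def ArcsIncreasing (P : Set Pt) (e : Sym2 Pt) (ℓ : ℕ) :
    Set (Sym2 Pt) → List (FlipData × ℕ) → Prop
  | _, [] => True
  | T, y :: L => (e = y.1.1 ∨ ShareTriangle P T e y.1.1 → ℓ < y.2) ∧
      (y.1.1 ≠ e → ArcsIncreasing P e ℓ (flipStep T y.1) L)

/-- A valid sequence of labelled flips in which labels increase along arcs. -/
def ValidIncreasing (P : Set Pt) (Tr : Set (Sym2 Pt)) :
    Set (Sym2 Pt) → List (FlipData × ℕ) → Prop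
  | T, [] => T = Tr
  | T, x :: L => FlipsTo P T (flipStep T x.1) x.1 ∧
      ArcsIncreasing P x.1.2 x.2 (flipStep T x.1) L ∧ ValidIncreasing P Tr (flipStep T x.1) L

lemma ValidIncreasing.independent {x y : FlipData × ℕ} {L : List (FlipData × ℕ)}
    (h : ValidIncreasing P Tr T (x :: y :: L)) (hxy : y.2 < x.2) : Independent P T x.1 y.1 :=
  ⟨fun he => (h.2.1.1 (.inl he)).not_gt hxy, fun he => (h.2.1.1 (.inr he)).not_gt hxy⟩

lemma ValidIncreasing.swap {x y : FlipData × ℕ} {L : List (FlipData × ℕ)}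
    (h : ValidIncreasing P Tr T (x :: y :: L)) (hxy : y.2 < x.2) :
    ValidIncreasing P Tr T (y :: x :: L) := by
  have hi := h.independent hxy
  obtain ⟨hx, hax, hy, hay, hL⟩ := h
  obtain ⟨h1, h2, h3⟩ := hi.swap hx hy
  refine ⟨h1, ⟨fun _ => hxy, fun _ => ?_⟩, h2, ?_, ?_⟩ <;> rw [h3]
  · exact hay
  · exact hax.2 hi.1.symm
  · exact hL

lemma ArcsIncreasing.swap {x y : FlipData × ℕ} {L : List (FlipData × ℕ)} {e : Sym2 Pt} {ℓ : ℕ}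
    (h : ValidIncreasing P Tr T (x :: y :: L)) (hxy : y.2 < x.2)
    (he : ArcsIncreasing P e ℓ T (x :: y :: L)) : ArcsIncreasing P e ℓ T (y :: x :: L) := by
  have hi := h.independent hxy
  obtain ⟨hx, -, hy, -, -⟩ := h
  obtain ⟨-, -, h3⟩ := hi.swap hx hy
  have hne : x.1.1 ≠ y.1.1 := fun h => hx.fst_notMem (h ▸ hy.2.1)
  refine ⟨?_, fun hey => ⟨?_, fun hex => ?_⟩⟩
  · rintro (rfl | hs)
    · exact (he.2 hne).1 (.inl rfl)
    · obtain ⟨h4, h5⟩ := hi.shareTriangle_flipStep hx hy hs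
      exact (he.2 h4.symm).1 (.inr h5)
  · rintro (rfl | hs)
    · exact he.1 (.inl rfl)
    · exact he.1 (.inr (hi.shareTriangle_of_flipStep hx hy hs))
  · rw [h3]
    exact (he.2 hex).2 hey

lemma ValidIncreasing.orderedInsert (x : FlipData × ℕ) (L : List (FlipData × ℕ)) :
    ∀ T, ValidIncreasing P Tr T (x :: L) →
      ValidIncreasing P Tr T (L.orderedInsert (fun p q => p.2 ≤ q.2) x) ∧
      ∀ e ℓ, ArcsIncreasing P e ℓ T (x :: L) →
        ArcsIncreasing P e ℓ T (L.orderedInsert (fun p q => p.2 ≤ q.2) x) := by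
  induction L with
  | nil => exact fun T h => ⟨h, fun _ _ => id⟩
  | cons y L ih =>
    intro T h
    rw [List.orderedInsert_cons]
    split_ifs with hxy
    · exact ⟨h, fun _ _ => id⟩
    · rw [not_le] at hxy
      obtain ⟨h1, h2, h3⟩ := h.swap hxy
      obtain ⟨ih1, ih2⟩ := ih _ h3
      refine ⟨⟨h1, ih2 _ _ h2, ih1⟩, fun e ℓ he => ?_⟩
      have := he.swap h hxy
      exact ⟨this.1, fun hne => ih2 _ _ (this.2 hne)⟩

lemma ValidIncreasing.insertionSort (L : List (FlipData × ℕ)) :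
    ∀ T, ValidIncreasing P Tr T L →
      ValidIncreasing P Tr T (L.insertionSort fun p q => p.2 ≤ q.2) ∧
      ∀ e ℓ, ArcsIncreasing P e ℓ T L →
        ArcsIncreasing P e ℓ T (L.insertionSort fun p q => p.2 ≤ q.2) := by
  induction L with
  | nil => exact fun T h => ⟨h, fun _ _ => id⟩
  | cons x L ih =>
    rintro T ⟨h1, h2, h3⟩
    obtain ⟨ih1, ih2⟩ := ih _ h3
    obtain ⟨h4, h5⟩ := ValidIncreasing.orderedInsert x _ T ⟨h1, ih2 _ _ h2, ih1⟩
    exact ⟨h4, fun e ℓ he => h5 e ℓ ⟨he.1, fun hne => ih2 _ _ (he.2 hne)⟩⟩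

lemma ValidIncreasing.validSeq (L : List (FlipData × ℕ)) :
    ∀ T, ValidIncreasing P Tr T L → ValidSeq P T (L.map Prod.fst) Tr := by
  induction L with
  | nil => exact fun T h => h
  | cons x L ih => exact fun T h => ⟨_, h.1, ih _ h.2.2⟩

/-- Attach the labels `lab 0, lab 1, …` to a list of flips. -/
def labelled (lab : ℕ → ℕ) : List FlipData → List (FlipData × ℕ)
  | [] => []
  | f :: F => (f, lab 0) :: labelled (fun i => lab (i + 1)) F

lemma labelled_eq_ofFn (F : List FlipData) (lab : ℕ → ℕ) :
    labelled lab F = List.ofFn fun i : Fin F.length => (F.get i, lab i) := by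
  induction F generalizing lab with
  | nil => rfl
  | cons f F ih => simp [labelled, ih, List.ofFn_succ]

lemma arcsIncreasing_labelled (F : List FlipData) (e : Sym2 Pt) (ℓ : ℕ) :
    ∀ (T : Set (Sym2 Pt)) (lab : ℕ → ℕ),
      (∀ j, ∀ hj : j < F.length,
        (e = (F.get ⟨j, hj⟩).1 ∨ ShareTriangle P (applyFlips T (F.take j)) e (F.get ⟨j, hj⟩).1) →
        (∀ p, ∀ hp : p < F.length, p < j → (F.get ⟨p, hp⟩).1 ≠ e) → ℓ < lab j) →
      ArcsIncreasing P e ℓ T (labelled lab F) := by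
  induction F with
  | nil => exact fun _ _ _ => trivial
  | cons f F ih =>
    intro T lab h
    refine ⟨fun he => h 0 (by simp) he (by simp), fun hne => ih _ _ fun j hj he hp => ?_⟩
    refine h (j + 1) (by simpa using hj) he fun p hp' hpj => ?_
    cases p with
    | zero => exact hne
    | succ p => exact hp p (by simpa using hp') (by omega)

lemma validIncreasing_labelled (F : List FlipData) :
    ∀ (T : Set (Sym2 Pt)) (lab : ℕ → ℕ), ValidSeq P T F Tr →
      (∀ i j, Arc P T F i j → lab i < lab j) → ValidIncreasing P Tr T (labelled lab F) := by
  induction F with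
  | nil => exact fun _ _ h _ => h
  | cons f F ih =>
    rintro T lab ⟨T₁, hf, hF⟩ harc
    obtain rfl := hf.eq_flipStep
    refine ⟨hf, arcsIncreasing_labelled F _ _ _ _ fun j hj he hp => ?_, ih _ _ hF ?_⟩
    · refine harc 0 (j + 1) ⟨by simp, by simpa using hj, by omega, he, fun p hp' h0 hpj => ?_⟩
      obtain ⟨p, rfl⟩ := Nat.exists_eq_succ_of_ne_zero h0.ne'
      exact hp p (by simpa using hp') (by omega)
    · rintro i j ⟨hi, hj, hij, he, hp⟩
      refine harc (i + 1) (j + 1) ⟨by simpa using hi, by simpa using hj, by omega, he,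
        fun p hp' h0 hpj => ?_⟩
      obtain ⟨p, rfl⟩ := Nat.exists_eq_succ_of_ne_zero (by omega : p ≠ 0)
      exact hp p (by simpa using hp') (by omega) (by omega)

end LabelledSequences

/-- **Lemma 1.** Any permutation of a valid flip sequence `F` that is a
topological sorting of `D_F` is again a valid sequence from `T₀` to `T_r`. -/
theorem topological_sorting_is_valid
    (P : Set Pt) (hfin : P.Finite) (hncol : ¬ Collinear ℝ P)
    (T₀ Tr : Set (Sym2 Pt)) (F F' : List FlipData)
    (hF : ValidSeq P T₀ F Tr)
    (htopo : IsTopologicalSorting P T₀ F F') :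
    ValidSeq P T₀ F' Tr := by
  obtain ⟨hlen, σ, hσ, harc⟩ := htopo
  let lab : ℕ → ℕ := fun i => if h : i < F.length then (σ.symm ⟨i, h⟩ : ℕ) else 0
  have hlab : ∀ i : Fin F.length, lab i = (σ.symm i : ℕ) := fun i => by simp [lab]
  have hvalid := validIncreasing_labelled F T₀ lab hF (by
    rintro i j ⟨hi, hj, h⟩
    have := harc (σ.symm ⟨i, hi⟩) (σ.symm ⟨j, hj⟩) (by simpa using ⟨hi, hj, h⟩)
    simpa [lab, hi, hj] using this)
  have hsort := (ValidIncreasing.insertionSort _ _ hvalid).1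
  have hsorted : (labelled lab F).insertionSort (fun p q => p.2 ≤ q.2) =
      List.ofFn fun m => (F.get (σ m), (m : ℕ)) := by
    have hperm : ((labelled lab F).insertionSort (fun p q => p.2 ≤ q.2)).Perm
        (List.ofFn fun m => (F.get (σ m), (m : ℕ))) := by
      refine (List.perm_insertionSort _ _).trans ?_
      rw [labelled_eq_ofFn]
      have := Equiv.Perm.ofFn_comp_perm σ (fun i : Fin F.length => (F.get i, lab i))
      simpa [Function.comp_def, hlab] using this.symm
    have hle : ∀ p q : FlipData × ℕ, p.2 ≤ q.2 ∨ q.2 ≤ p.2 := fun p q => le_total _ _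
    have : Std.Total (fun p q : FlipData × ℕ => p.2 ≤ q.2) := ⟨hle⟩
    have : IsTrans (FlipData × ℕ) (fun p q => p.2 ≤ q.2) := ⟨fun _ _ _ => le_trans⟩
    refine hperm.eq_of_pairwise ?_ (List.pairwise_insertionSort _ _) ?_
    · intro p q hp hq h1 h2
      have hp' := hperm.subset hp
      rw [List.mem_ofFn] at hp' hq
      obtain ⟨m, rfl⟩ := hp'
      obtain ⟨n, rfl⟩ := hq
      obtain rfl : m = n := Fin.ext (le_antisymm h1 h2)
      rfl
    · rw [List.pairwise_ofFn]
      exact fun m n h => h.le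
  rw [hsorted] at hsort
  have hF' : F' = (List.ofFn fun m => (F.get (σ m), (m : ℕ))).map Prod.fst := by
    rw [List.map_ofFn]
    refine List.ext_get (by simp [hlen]) fun k h1 h2 => ?_
    have := hσ ⟨k, hlen ▸ h1⟩
    simpa using this
  rw [hF']
  exact ValidIncreasing.validSeq _ _ hsort

end
end
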